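/- arXiv:1203.2484 — 2 statements merged into one kernel-verified Lean document; each statement's English description precedes it below -/
import Mathlib

section
/- Let (R,M,k) be a regular local ring with regular system of parameters (y,u_1,...,u_d), f ∈ M with f ∉ (u_1,...,u_d), and L(x_1,...,x_d) = λ_1x_1+···+λ_dx_d a nonzero linear form with λ_i ∈ ℚ_{≥0}. Set I := {i : λ_i > 0} and l := l(f,u,y) = min{L(a) : a ∈ Δ(f;u;y)}. If l ≠ 0, then the associated graded ring of R with respect to the monomial valuation v_{L,u,y,f} is gr_{v}(R) = (R/(y, {u_i}_{i∈I}))[Y, {U_i}_{i∈I}], a polynomial ring over R/(y,{u_i}_{i∈I}) in the variables Y = in y and U_i = in u_i, i ∈ I. -/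
/-!
Characteristic polyhedra of singularities without completion
(V. Cossart, O. Piltant), formalized statements.
-/

noncomputable section

open IsLocalRing TensorProduct

namespace CharPolyhedra

universe u v

/-! ### Polyhedral notions -/

/-- The nonnegative orthant in `ℝ^d`. -/
def orthant (d : ℕ) : Set (Fin d → ℝ) := {x | ∀ i, 0 ≤ x i}

/-- An `F`-subset of `ℝ_{≥0}^d`: a closed convex subset stable under translation
by the nonnegative orthant. -/
def IsFSubset {d : ℕ} (Δ : Set (Fin d → ℝ)) : Prop :=
  Δ ⊆ orthant d ∧ IsClosed Δ ∧ Convex ℝ Δ ∧ ∀ v ∈ Δ, ∀ w ∈ orthant d, v + w ∈ Δ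

/-- The smallest `F`-subset containing a given set of points. -/
def smallestFSubset {d : ℕ} (X : Set (Fin d → ℝ)) : Set (Fin d → ℝ) :=
  ⋂₀ {Δ | IsFSubset Δ ∧ X ⊆ Δ}

/-- A vertex of an `F`-subset: a point cut out by a positive linear form. -/
def IsVertex {d : ℕ} (Δ : Set (Fin d → ℝ)) (v : Fin d → ℝ) : Prop :=
  ∃ L : Fin d → ℝ, (∀ i, 0 < L i) ∧ Δ ∩ {x | ∑ i, L i * x i = 1} = {v}

/-- A rational polyhedron: an `F`-subset cut out by finitely many nonnegative
rational linear forms. -/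
def IsRationalPolyhedron {d : ℕ} (Δ : Set (Fin d → ℝ)) : Prop :=
  ∃ (n : ℕ) (L : Fin n → Fin d → ℚ), (∀ j i, 0 ≤ L j i) ∧
    Δ = {x | x ∈ orthant d ∧ ∀ j, 1 ≤ ∑ i, (L j i : ℝ) * x i}

/-- `min {L(a) : a ∈ Δ}` for a linear form with rational coefficients `L`. -/
def ellOf {d : ℕ} (L : Fin d → ℚ) (Δ : Set (Fin d → ℝ)) : ℝ :=
  sInf ((fun x => ∑ i, (L i : ℝ) * x i) '' Δ)

/-! ### Regular local rings, systems of parameters -/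

/-- A family `s` of `n` elements is a regular system of parameters of the local
ring `R`: it generates the maximal ideal and `n` equals the Krull dimension. -/
def IsSysOfParams (R : Type u) [CommRing R] [IsLocalRing R] {n : ℕ} (s : Fin n → R) : Prop :=
  Ideal.span (Set.range s) = maximalIdeal R ∧ ringKrullDim R = n

/-- `(y, u 0, ..., u (d-1))` is a regular system of parameters of `R`. -/
def IsRSP (R : Type u) [CommRing R] [IsLocalRing R] {d : ℕ} (y : R) (u : Fin d → R) : Prop :=
  IsSysOfParams R (Fin.cons y u)

/-- A regular local ring: a Noetherian local ring whose maximal ideal is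
generated by a regular system of parameters. -/
def IsRegularLocalRing (R : Type u) [CommRing R] [IsLocalRing R] : Prop :=
  IsNoetherianRing R ∧ ∃ (n : ℕ) (s : Fin n → R), IsSysOfParams R s

/-- A regular ring: a Noetherian ring all of whose localizations at primes are
regular local rings. -/
def IsRegularRing (A : Type u) [CommRing A] : Prop :=
  IsNoetherianRing A ∧ ∀ (P : Ideal A) [P.IsPrime],
    IsRegularLocalRing (Localization.AtPrime P)

/-! ### Monomial expansions and polyhedra -/

variable {R : Type u} [CommRing R]

/-- The monomial `y^b u^a`, where `ab = (a, b)`. -/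
def monomial {d : ℕ} (y : R) (u : Fin d → R) (ab : (Fin d → ℕ) × ℕ) : R :=
  y ^ ab.2 * ∏ i, u i ^ ab.1 i

/-- A finite expansion `f = Σ_{(a,b)} C_{a,b} y^b u^a` with all coefficients units. -/
def IsUnitExpansion {d : ℕ} (f y : R) (u : Fin d → R)
    (c : ((Fin d → ℕ) × ℕ) →₀ R) : Prop :=
  (∀ ab ∈ c.support, IsUnit (c ab)) ∧ f = c.sum fun ab r => r * monomial y u ab

/-- The projection `(a, b) ↦ a / (m - b)` from the point `(0, m)`. -/
def projPoint {d : ℕ} (m : ℕ) (ab : (Fin d → ℕ) × ℕ) : Fin d → ℝ :=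
  fun i => (ab.1 i : ℝ) / ((m : ℝ) - (ab.2 : ℝ))

/-- The projected points attached to (the support of) an expansion. -/
def expPoints {d : ℕ} (m : ℕ) (s : Finset ((Fin d → ℕ) × ℕ)) : Set (Fin d → ℝ) :=
  {x | ∃ ab ∈ s, ab.2 < m ∧ x = projPoint m ab}

/-- The polyhedron `Δ(f; u; y)` computed with prescribed order `m`: the smallest
`F`-subset containing the projected supports of all finite unit-coefficient
expansions of `f` in the parameters `(y, u)`. -/
def DeltaOf {d : ℕ} (f y : R) (u : Fin d → R) (m : ℕ) : Set (Fin d → ℝ) :=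
  smallestFSubset (⋃ c ∈ {c | IsUnitExpansion f y u c}, expPoints m c.support)

/-- The order of the image of `f` in `R/(u_1, ..., u_d)`, i.e. the largest `n`
with `f ∈ M^n + (u_1, ..., u_d)`. -/
def ordRes {d : ℕ} [IsLocalRing R] (f : R) (u : Fin d → R) : ℕ :=
  sSup {n : ℕ | f ∈ (maximalIdeal R) ^ n ⊔ Ideal.span (Set.range u)}

/-- Hironaka's polyhedron `Δ(f; u_1, ..., u_d; y)`. -/
def Delta {d : ℕ} [IsLocalRing R] (f y : R) (u : Fin d → R) : Set (Fin d → ℝ) :=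
  DeltaOf f y u (ordRes f u)

/-! ### Completion and the characteristic polyhedron -/

/-- The `M`-adic completion `R̂` of a local ring `R`. -/
abbrev Completion (R : Type u) [CommRing R] [IsLocalRing R] : Type u :=
  AdicCompletion (maximalIdeal R) R

/-- The canonical map `R → R̂`. -/
def cmpl {R : Type u} [CommRing R] [IsLocalRing R] : R →+* Completion R :=
  algebraMap R (Completion R)

/-- `(ŷ, u_1, ..., u_d)` is a regular system of parameters of the completion
`R̂`: it generates the maximal ideal `M·R̂` of `R̂`. -/
def IsRSPhat (R : Type u) [CommRing R] [IsLocalRing R] {d : ℕ}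
    (yh : Completion R) (u : Fin d → R) : Prop :=
  Ideal.span (insert yh (Set.range fun i => cmpl (u i)))
    = (maximalIdeal R).map (cmpl (R := R))

/-- Hironaka's characteristic polyhedron `Δ(f; u_1, ..., u_d)`: the intersection
of the `Δ(f; u; ŷ)` over all regular systems of parameters `(ŷ, u_1, ..., u_d)`
of the completion `R̂`. -/
def CharPolyhedron {d : ℕ} [IsLocalRing R] (f : R) (u : Fin d → R) : Set (Fin d → ℝ) :=
  ⋂ yh ∈ {yh : Completion R | IsRSPhat R yh u},
    DeltaOf (cmpl f) yh (fun i => cmpl (u i)) (ordRes f u)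

/-! ### G-rings, excellence -/

/-- A `κ`-algebra `A` is geometrically regular if `κ' ⊗[κ] A` is a regular ring
for every finite field extension `κ'/κ`. -/
def IsGeometricallyRegularAlgebra (κ : Type u) [Field κ] (A : Type v) [CommRing A]
    [Algebra κ A] : Prop :=
  ∀ (κ' : Type u) [Field κ'] [Algebra κ κ'] [Module.Finite κ κ'],
    IsRegularRing (κ' ⊗[κ] A)

/-- A local ring has geometrically regular formal fibers if, for every prime
`P ⊂ R`, the formal fiber `κ(P) ⊗_R R̂` is a geometrically regular
`κ(P)`-algebra. -/
def HasGeomRegularFormalFibers (R : Type u) [CommRing R] [IsLocalRing R] : Prop :=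
  ∀ (P : Ideal R) [P.IsPrime],
    IsGeometricallyRegularAlgebra (ResidueField (Localization.AtPrime P))
      (ResidueField (Localization.AtPrime P) ⊗[R] Completion R)

/-- A G-ring: a Noetherian ring all of whose localizations at primes have
geometrically regular formal fibers. -/
def IsGRing (A : Type u) [CommRing A] : Prop :=
  IsNoetherianRing A ∧ ∀ (P : Ideal A) [P.IsPrime],
    HasGeomRegularFormalFibers (Localization.AtPrime P)

/-- A saturated chain of primes: each step is a covering relation. -/
def IsSaturatedChain {A : Type u} [CommRing A] (c : LTSeries (PrimeSpectrum A)) : Prop :=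
  ∀ i : Fin c.length, c.toFun i.castSucc ⋖ c.toFun i.succ

/-- A catenary ring: any two saturated chains of primes with the same endpoints
have the same length. -/
def IsCatenary (A : Type u) [CommRing A] : Prop :=
  ∀ (c₁ c₂ : LTSeries (PrimeSpectrum A)), c₁.head = c₂.head → c₁.last = c₂.last →
    IsSaturatedChain c₁ → IsSaturatedChain c₂ → c₁.length = c₂.length

/-- Universally catenary: all polynomial rings over `A` are catenary. -/
def IsUniversallyCatenary (A : Type u) [CommRing A] : Prop :=
  ∀ n : ℕ, IsCatenary (MvPolynomial (Fin n) A)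

/-- The regular locus of any domain finite over `A` is open. -/
def HasOpenRegularLocus (A : Type u) [CommRing A] : Prop :=
  ∀ (B : Type u) [CommRing B] [IsDomain B] [Algebra A B] [Module.Finite A B],
    IsOpen {P : PrimeSpectrum B | IsRegularLocalRing (Localization.AtPrime P.asIdeal)}

/-- Quasi-excellent: a G-ring with open regular loci for finite domains over it. -/
def IsQuasiExcellent (A : Type u) [CommRing A] : Prop :=
  IsGRing A ∧ HasOpenRegularLocus A

/-- Excellent: universally catenary and quasi-excellent. -/
def IsExcellent (A : Type u) [CommRing A] : Prop :=
  IsUniversallyCatenary A ∧ IsQuasiExcellent A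

/-! ### Monomial valuations and associated graded rings -/

/-- The weight `l·b + L(a)` of the monomial `y^b u^a`. -/
def weight {d : ℕ} (l : ℝ) (L : Fin d → ℝ) (ab : (Fin d → ℕ) × ℕ) : ℝ :=
  l * (ab.2 : ℝ) + ∑ i, L i * (ab.1 i : ℝ)

/-- The ideal `I_λ` generated by the monomials `y^b u^a` with `l·b + L(a) ≥ λ`. -/
def monIdeal {d : ℕ} (y : R) (u : Fin d → R) (l : ℝ) (L : Fin d → ℝ) (lam : ℝ) :
    Ideal R :=
  Ideal.span {g | ∃ ab : (Fin d → ℕ) × ℕ, g = monomial y u ab ∧ lam ≤ weight l L ab}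

/-- The monomial valuation `v(g) := max {λ : g ∈ I_λ}`. -/
def vval {d : ℕ} (y : R) (u : Fin d → R) (l : ℝ) (L : Fin d → ℝ) (g : R) : ℝ :=
  sSup {lam : ℝ | g ∈ monIdeal y u l L lam}

/-- The Rees algebra `⊕_λ I_λ` of the filtration `(I_λ)`, realized inside the
monoid algebra `R[ℝ]`. -/
def ReesAlgebra {d : ℕ} (y : R) (u : Fin d → R) (l : ℝ) (L : Fin d → ℝ) :
    Subalgebra R (AddMonoidAlgebra R ℝ) :=
  Algebra.adjoin R {p | ∃ (lam : ℝ) (x : R), x ∈ monIdeal y u l L lam ∧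
    p = AddMonoidAlgebra.single lam x}

/-- The ideal `⊕_λ I_{λ⁺}` of the Rees algebra. -/
def grIdeal {d : ℕ} (y : R) (u : Fin d → R) (l : ℝ) (L : Fin d → ℝ) :
    Ideal (ReesAlgebra y u l L) :=
  Ideal.span {p | ∃ (lam : ℝ) (x : R), (∃ lam' > lam, x ∈ monIdeal y u l L lam') ∧
    (p : AddMonoidAlgebra R ℝ) = AddMonoidAlgebra.single lam x}

/-- The associated graded ring `gr_v(R) = ⊕_λ I_λ / I_{λ⁺}` of `R` with respect
to the monomial valuation `v`, realized as `(⊕_λ I_λ) / (⊕_λ I_{λ⁺})`. -/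
abbrev GrRing {d : ℕ} (y : R) (u : Fin d → R) (l : ℝ) (L : Fin d → ℝ) : Type u :=
  ReesAlgebra y u l L ⧸ grIdeal y u l L

/-- `x ∈ gr_v(R)` is the initial form of `g ∈ R`: the class of `g` placed in
degree `v(g)`. -/
def IsInitialForm {d : ℕ} (y : R) (u : Fin d → R) (l : ℝ) (L : Fin d → ℝ) (g : R)
    (x : GrRing y u l L) : Prop :=
  ∃ h : AddMonoidAlgebra.single (vval y u l L g) g ∈ ReesAlgebra y u l L,
    x = Ideal.Quotient.mk (grIdeal y u l L)
      ⟨AddMonoidAlgebra.single (vval y u l L g) g, h⟩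


theorem cancelAux (a m : ℕ) (x : WithBot ℕ∞) (h : ((a : WithBot ℕ∞) + (m : ℕ)) ≤ x + (m : ℕ)) :
    (a : WithBot ℕ∞) ≤ x := by
  induction x with
  | bot =>
    rw [WithBot.bot_add, le_bot_iff] at h
    exact absurd h (by rw [← Nat.cast_add]; exact WithBot.coe_ne_bot (a := ((a + m : ℕ) : ℕ∞)))
  | coe e =>
    have h' : (((a : ℕ∞) + (m : ℕ∞) : ℕ∞) : WithBot ℕ∞) ≤ ((e + m : ℕ∞) : WithBot ℕ∞) := h
    rw [WithBot.coe_le_coe] at h'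
    have : (a : ℕ∞) ≤ e := (ENat.add_le_add_iff_right (ENat.natCast_ne_top m)).1 h'
    exact WithBot.coe_le_coe.2 this

theorem aux_gen {R : Type*} [CommRing R] [IsLocalRing R] (S : Finset R)
    (hS : Ideal.span (S : Set R) = maximalIdeal R) (x : R) (hx : x ∈ maximalIdeal R)
    (hx2 : x ∉ maximalIdeal R ^ 2) :
    ∃ s ∈ S, maximalIdeal R ≤ Ideal.span (insert x (↑S \ {s})) := by
  classical
  have hx' := hx
  rw [← hS] at hx'
  obtain ⟨c, hc⟩ := (Submodule.mem_span_finset'.1 hx')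
  have : ∃ s : S, IsUnit (c s) := by
    by_contra h
    push Not at h
    apply hx2
    rw [← hc, pow_two]
    refine Ideal.sum_mem _ fun s _ => ?_
    exact Ideal.mul_mem_mul ((mem_maximalIdeal _).2 (h s)) (hS ▸ Ideal.subset_span s.2)
  obtain ⟨s, v, hv⟩ := this
  refine ⟨s, s.2, ?_⟩
  rw [← hS, Ideal.span_le]
  intro t ht
  by_cases hts : t = s
  · subst hts
    have hmem : ∀ a : S, a ≠ s → c a * (a : R) ∈ Ideal.span (insert x (↑S \ {(s : R)})) := by
      intro a ha
      exact Ideal.mul_mem_left _ _ (Ideal.subset_span (Or.inr ⟨a.2, fun h => ha (Subtype.ext h)⟩))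
    rw [Fintype.sum_eq_add_sum_compl s] at hc
    have h1 : c s * (s : R) ∈ Ideal.span (insert x (↑S \ {(s : R)})) := by
      have : c s * (s : R) = x - ∑ i ∈ {s}ᶜ, c i • (i : R) := by rw [← hc]; simp
      rw [this]
      refine Ideal.sub_mem _ (Ideal.subset_span (Or.inl rfl)) (Ideal.sum_mem _ fun i hi => hmem i ?_)
      simpa using hi
    rw [← hv] at h1
    have := Ideal.mul_mem_left _ (↑v⁻¹ : R) h1
    simpa using this
  · exact Ideal.subset_span (Or.inr ⟨ht, hts⟩)

theorem regDomain (n : ℕ) : ∀ (R : Type*) [CommRing R] [IsLocalRing R] [IsNoetherianRing R]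
    (S : Finset R) (_ : Ideal.span (S : Set R) = maximalIdeal R) (_ : S.card ≤ n)
    (_ : (n : WithBot ℕ∞) ≤ ringKrullDim R), IsDomain R := by
  induction n with
  | zero =>
    intro R _ _ _ S hS hc _
    have : S = ∅ := by simpa using hc
    subst this
    have h : maximalIdeal R = ⊥ := by rw [← hS]; simp
    exact ((isField_iff_maximalIdeal_eq).2 h).isDomain
  | succ n ih =>
    intro R _ _ _ S hS hc hd
    classical
    have hmnot : ∀ P ∈ minimalPrimes R, ¬ maximalIdeal R ≤ P := by
      intro P hP hle
      have hPp : P.IsPrime := hP.1.1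
      have hPm : P = maximalIdeal R := le_antisymm (le_maximalIdeal hPp.ne_top) hle
      have h0 : P.height = 0 := Ideal.height_eq_zero_iff.2 hP
      have := maximalIdeal_height_eq_ringKrullDim (R := R)
      rw [← hPm, h0] at this
      rw [← this] at hd
      have : ((n + 1 : ℕ) : WithBot ℕ∞) ≤ ((0 : ℕ) : WithBot ℕ∞) := hd
      norm_cast at this
    have hm2 : ¬ maximalIdeal R ≤ maximalIdeal R ^ 2 := by
      intro hle
      have : maximalIdeal R = ⊥ := by
        refine Submodule.eq_bot_of_le_smul_of_le_jacobson_bot (maximalIdeal R) (maximalIdeal R)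
          (IsNoetherian.noetherian _) (by simpa [pow_two] using hle) (maximalIdeal_le_jacobson _)
      obtain ⟨P, hP⟩ := Ideal.nonempty_minimalPrimes (I := (⊥ : Ideal R)) bot_ne_top
      exact hmnot P hP (by rw [this]; exact bot_le)
    have hfin : (minimalPrimes R).Finite := minimalPrimes.finite_of_isNoetherianRing R
    obtain ⟨x, hx, hxn⟩ : ∃ x ∈ maximalIdeal R, x ∉ maximalIdeal R ^ 2 ∧ ∀ P ∈ minimalPrimes R, x ∉ P := by
      by_contra hcon
      push Not at hcon
      have := (Ideal.subset_union_prime (s := insert (maximalIdeal R ^ 2) hfin.toFinset) (f := id)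
        (maximalIdeal R ^ 2) (maximalIdeal R ^ 2) (I := maximalIdeal R) (by
          intro i hi h1 _
          have : i ∈ minimalPrimes R := by simpa [h1] using hi
          exact this.1.1)).1 (by
          intro x hx
          by_cases h : x ∈ maximalIdeal R ^ 2
          · simp only [Set.mem_iUnion]
            exact ⟨_, Finset.mem_insert_self _ _, h⟩
          · obtain ⟨P, hP, hxP⟩ := hcon x hx h
            simp only [Set.mem_iUnion]
            exact ⟨P, Finset.mem_insert_of_mem (by simpa using hP), hxP⟩)
      obtain ⟨i, hi, hle⟩ := this
      rcases Finset.mem_insert.1 hi with rfl | hi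
      · exact hm2 hle
      · exact hmnot i (by simpa using hi) hle
    obtain ⟨hx2, hxP⟩ := hxn
    obtain ⟨s, hs, hgen⟩ := aux_gen S hS x hx hx2
    have hne : Ideal.span {x} ≠ ⊤ := fun h => by
      have : Ideal.span {x} ≤ maximalIdeal R := by rw [Ideal.span_le]; simpa using hx
      rw [h] at this
      exact (maximalIdeal.isMaximal R).ne_top (top_le_iff.1 this)
    have : Nontrivial (R ⧸ Ideal.span {x}) := Ideal.Quotient.nontrivial_iff.2 hne
    have : IsLocalRing (R ⧸ Ideal.span {x}) := IsLocalRing.of_surjective' (Ideal.Quotient.mk _) Ideal.Quotient.mk_surjective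
    have hmap : (maximalIdeal R).map (Ideal.Quotient.mk (Ideal.span {x})) = maximalIdeal (R ⧸ Ideal.span {x}) :=
      IsLocalRing.map_maximalIdeal_of_surjective _ Ideal.Quotient.mk_surjective
    have hdom : IsDomain (R ⧸ Ideal.span {x}) := by
      refine ih _ ((S.erase s).image (Ideal.Quotient.mk _)) ?_ ?_ ?_
      · rw [← hmap]
        apply le_antisymm
        · rw [Ideal.span_le, ← hS]
          intro t ht
          simp only [Finset.coe_image, Set.mem_image] at ht
          obtain ⟨r, hr, rfl⟩ := ht
          exact Ideal.mem_map_of_mem _ (Ideal.subset_span (by simp at hr; exact hr.1))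
        · refine (Ideal.map_mono hgen).trans ?_
          rw [Ideal.map_span, Ideal.span_le]
          rintro _ ⟨t, ht, rfl⟩
          rcases ht with rfl | ht
          · have : Ideal.Quotient.mk (Ideal.span {t}) t = 0 := Ideal.Quotient.eq_zero_iff_mem.2 (Ideal.mem_span_singleton_self t)
            rw [this]; exact Ideal.zero_mem _
          · exact Ideal.subset_span (by simpa using ⟨t, ⟨ht.1, ht.2⟩, rfl⟩)
      · refine Finset.card_image_le.trans ?_
        rw [Finset.card_erase_of_mem hs]; omega
      · have := ringKrullDim_le_ringKrullDim_quotient_add_card (R := R) {x} (by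
          rw [ringJacobson_eq_maximalIdeal]; simpa using hx)
        have h2 := hd.trans this
        rw [Finset.card_singleton, Nat.cast_add, Finset.coe_singleton] at h2
        exact cancelAux n 1 _ h2
    have hprime : (Ideal.span {x}).IsPrime := (Ideal.Quotient.isDomain_iff_prime _).1 hdom
    obtain ⟨P, hP, hPle⟩ := Ideal.exists_minimalPrimes_le (I := ⊥) (J := Ideal.span {x}) bot_le
    have hPp : P.IsPrime := hP.1.1
    have hPbot : P = ⊥ := by
      refine Submodule.eq_bot_of_le_smul_of_le_jacobson_bot (maximalIdeal R) P
          (IsNoetherian.noetherian _) ?_ (maximalIdeal_le_jacobson _)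
      intro p hp
      obtain ⟨a, rfl⟩ := Ideal.mem_span_singleton'.1 (hPle hp)
      have : a ∈ P := (hPp.mem_or_mem hp).resolve_right (hxP P hP)
      rw [mul_comm]
      exact Submodule.smul_mem_smul hx this
    subst hPbot
    exact IsDomain.of_bot_isPrime R

theorem quotDomain {R : Type*} [CommRing R] [IsLocalRing R] [IsNoetherianRing R] {n : ℕ}
    (z : Fin n → R) (hz : Ideal.span (Set.range z) = maximalIdeal R) (hd : ringKrullDim R = n)
    (T : Finset (Fin n)) : (Ideal.span (z '' T)).IsPrime := by
  classical
  have hle : Ideal.span (z '' T) ≤ maximalIdeal R := by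
    rw [← hz]; exact Ideal.span_mono (Set.image_subset_range _ _)
  have hne : Ideal.span (z '' T) ≠ ⊤ := fun h => by
    rw [h] at hle
    exact (maximalIdeal.isMaximal R).ne_top (top_le_iff.1 hle)
  have : Nontrivial (R ⧸ Ideal.span (z '' T)) := Ideal.Quotient.nontrivial_iff.2 hne
  have : IsLocalRing (R ⧸ Ideal.span (z '' T)) := IsLocalRing.of_surjective' (Ideal.Quotient.mk _) Ideal.Quotient.mk_surjective
  have hmap : (maximalIdeal R).map (Ideal.Quotient.mk (Ideal.span (z '' T))) = maximalIdeal (R ⧸ Ideal.span (z '' T)) :=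
    IsLocalRing.map_maximalIdeal_of_surjective _ Ideal.Quotient.mk_surjective
  rw [← Ideal.Quotient.isDomain_iff_prime]
  refine regDomain (n - T.card) _ (Tᶜ.image fun i => Ideal.Quotient.mk _ (z i)) ?_ ?_ ?_
  · rw [← hmap, ← hz, Ideal.map_span]
    apply le_antisymm
    · apply Ideal.span_mono
      intro t ht
      simp only [Finset.coe_image, Set.mem_image] at ht
      obtain ⟨r, hr, rfl⟩ := ht
      exact ⟨_, ⟨r, rfl⟩, rfl⟩
    · rw [Ideal.span_le]
      rintro _ ⟨_, ⟨i, rfl⟩, rfl⟩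
      by_cases hi : i ∈ T
      · have : Ideal.Quotient.mk (Ideal.span (z '' T)) (z i) = 0 :=
          Ideal.Quotient.eq_zero_iff_mem.2 (Ideal.subset_span ⟨i, hi, rfl⟩)
        rw [this]; exact Ideal.zero_mem _
      · exact Ideal.subset_span (by simpa using ⟨i, hi, rfl⟩)
  · refine Finset.card_image_le.trans ?_
    rw [Finset.card_compl]; simp
  · have h := ringKrullDim_le_ringKrullDim_quotient_add_card (R := R) (T.image z) (by
      rw [ringJacobson_eq_maximalIdeal, ← hz]
      intro t ht
      simp only [Finset.coe_image, Set.mem_image] at ht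
      obtain ⟨r, hr, rfl⟩ := ht
      exact Ideal.subset_span ⟨r, rfl⟩)
    rw [hd, Finset.coe_image] at h
    have hT : T.card ≤ n := by simpa using Finset.card_le_univ T
    have h2 : (((n - T.card : ℕ) : WithBot ℕ∞) + (T.card : ℕ)) ≤ ringKrullDim (R ⧸ Ideal.span (z '' T)) + (T.card : ℕ) := by
      rw [← Nat.cast_add, Nat.sub_add_cancel hT]
      refine h.trans ?_
      gcongr
      exact Finset.card_image_le
    exact cancelAux _ _ _ h2

theorem notMemSpan {R : Type*} [CommRing R] [IsLocalRing R] [IsNoetherianRing R] {n : ℕ}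
    (z : Fin n → R) (hz : Ideal.span (Set.range z) = maximalIdeal R) (hd : ringKrullDim R = n)
    (T : Finset (Fin n)) (j : Fin n) (hj : j ∉ T) : z j ∉ Ideal.span (z '' T) := by
  classical
  intro hmem
  have hsp : Ideal.span (((Finset.univ.erase j).image z : Finset R) : Set R) = maximalIdeal R := by
    rw [← hz]
    apply le_antisymm
    · apply Ideal.span_mono
      intro t ht
      simp only [Finset.coe_image, Set.mem_image] at ht
      obtain ⟨r, hr, rfl⟩ := ht
      exact ⟨_, rfl⟩
    · rw [Ideal.span_le]
      rintro _ ⟨i, rfl⟩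
      by_cases hi : i = j
      · subst hi
        refine Ideal.span_mono ?_ hmem
        rintro _ ⟨k, hk, rfl⟩
        simp only [Finset.coe_image, Set.mem_image]
        exact ⟨k, by simpa using fun h : k = i => hj (h ▸ hk), rfl⟩
      · exact Ideal.subset_span (by simpa using ⟨i, hi, rfl⟩)
  have h := ringKrullDim_le_ringKrullDim_quotient_add_card (R := R) ((Finset.univ.erase j).image z) (by
      rw [ringJacobson_eq_maximalIdeal, ← hsp]
      exact Ideal.subset_span)
  rw [hsp, hd] at h
  have h0 : ringKrullDim (R ⧸ maximalIdeal R) = 0 := ringKrullDim_eq_zero_of_field (ResidueField R)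
  rw [h0, zero_add] at h
  have h1 : n ≤ ((Finset.univ.erase j).image z).card := by exact_mod_cast h
  have h2 := h1.trans Finset.card_image_le
  rw [Finset.card_erase_of_mem (Finset.mem_univ _)] at h2
  have := j.pos
  simp at h2
  omega

/-- powers -/
theorem powReg {R ι : Type*} [CommRing R] (z : ι → R)
    (H : ∀ (T : Finset ι) (j : ι), j ∉ T → ∀ c, z j * c ∈ Ideal.span (z '' T) → c ∈ Ideal.span (z '' T))
    (N : ℕ) : ∀ (T : Finset ι) (p : ι → ℕ) (_ : ∀ i ∈ T, 1 ≤ p i) (_ : ∑ i ∈ T, p i ≤ N) (j : ι), j ∉ T →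
      ∀ c, z j * c ∈ Ideal.span ((fun i => z i ^ p i) '' T) → c ∈ Ideal.span ((fun i => z i ^ p i) '' T) := by
  classical
  induction N with
  | zero =>
    intro T p hp hs j hj c hc
    have : T = ∅ := by
      by_contra h
      obtain ⟨i, hi⟩ := Finset.nonempty_iff_ne_empty.2 h
      have := Finset.single_le_sum (f := p) (fun i _ => Nat.zero_le _) hi
      have := hp i hi
      omega
    subst this
    have := H ∅ j (by simp) c
    simp at this hc ⊢
    exact this hc
  | succ N ih =>
    intro T p hp hs j hj c hc
    by_cases h1 : ∀ i ∈ T, p i = 1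
    · have : (fun i => z i ^ p i) '' (T : Set ι) = z '' T :=
        Set.image_congr fun i hi => by simp [h1 i hi]
      rw [this] at hc ⊢
      exact H T j hj c hc
    push Not at h1
    obtain ⟨s, hsT, hps⟩ := h1
    have hps2 : 2 ≤ p s := by have := hp s hsT; omega
    obtain ⟨q, hq⟩ : ∃ q, p s = q + 1 := ⟨p s - 1, by omega⟩
    set K := Ideal.span ((fun i => z i ^ p i) '' (T.erase s : Finset ι)) with hK
    have hsum : p s + ∑ i ∈ T.erase s, p i = ∑ i ∈ T, p i := Finset.add_sum_erase _ _ hsT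
    have hsplit : ∀ p' : ι → ℕ, (∀ i, i ≠ s → p' i = p i) →
        Ideal.span ((fun i => z i ^ p' i) '' T) = Ideal.span {z s ^ p' s} ⊔ K := by
      intro p' hp'
      rw [hK, ← Ideal.span_union]
      congr 1
      ext t
      simp only [Set.mem_image, Set.mem_union, Set.mem_singleton_iff, Finset.coe_erase]
      constructor
      · rintro ⟨i, hi, rfl⟩
        by_cases his : i = s
        · subst his; left; rfl
        · right; exact ⟨i, ⟨hi, his⟩, by rw [hp' i his]⟩
      · rintro (rfl | ⟨i, ⟨hi, his⟩, rfl⟩)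
        · exact ⟨s, hsT, rfl⟩
        · exact ⟨i, hi, by rw [hp' i his]⟩
    -- z s is regular mod K
    have hreg : ∀ c, z s * c ∈ K → c ∈ K := by
      intro c hc
      exact ih (T.erase s) p (fun i hi => hp i (Finset.mem_of_mem_erase hi)) (by omega) s (by simp) c hc
    -- exponents with p s replaced
    have hgen : ∀ r, 1 ≤ r → r < p s → ∀ c, z j * c ∈ Ideal.span {z s ^ r} ⊔ K → c ∈ Ideal.span {z s ^ r} ⊔ K := by
      intro r hr1 hr c hc
      have e := hsplit (Function.update p s r) (fun i hi => Function.update_of_ne hi _ _)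
      rw [Function.update_self] at e
      rw [← e] at hc ⊢
      refine ih T _ ?_ ?_ j hj c hc
      · intro i hi
        by_cases his : i = s
        · subst his; simpa using hr1
        · rw [Function.update_of_ne his]; exact hp i hi
      · rw [← Finset.add_sum_erase _ _ hsT, Function.update_self,
          Finset.sum_congr rfl (fun i hi => Function.update_of_ne (Finset.ne_of_mem_erase hi) _ _)]
        omega
    rw [hsplit p (fun _ _ => rfl)] at hc ⊢
    rw [hq] at hc ⊢
    have hc1 : c ∈ Ideal.span {z s ^ 1} ⊔ K := by
      refine hgen 1 le_rfl (by omega) c ?_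
      refine sup_le_sup_right ?_ K hc
      rw [Ideal.span_singleton_le_span_singleton]
      exact pow_dvd_pow _ (by omega)
    obtain ⟨a, ha, k, hk, rfl⟩ := Submodule.mem_sup.1 hc1
    obtain ⟨c', rfl⟩ := Ideal.mem_span_singleton'.1 ha
    obtain ⟨a2, ha2, k2, hk2, e2⟩ := Submodule.mem_sup.1 hc
    obtain ⟨b, rfl⟩ := Ideal.mem_span_singleton'.1 ha2
    have h3 : z j * c' - b * z s ^ q ∈ K := by
      apply hreg
      have : z s * (z j * c' - b * z s ^ q) = k2 - z j * k := by
        linear_combination -e2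
      rw [this]
      exact Ideal.sub_mem _ hk2 (Ideal.mul_mem_left _ _ hk)
    have h4 : c' ∈ Ideal.span {z s ^ q} ⊔ K := by
      refine hgen q (by omega) (by omega) c' ?_
      have : z j * c' = b * z s ^ q + (z j * c' - b * z s ^ q) := by ring
      rw [this]
      exact Submodule.add_mem_sup (Ideal.mul_mem_left _ _ (Ideal.mem_span_singleton_self _)) h3
    obtain ⟨a3, ha3, k3, hk3, rfl⟩ := Submodule.mem_sup.1 h4
    obtain ⟨b3, rfl⟩ := Ideal.mem_span_singleton'.1 ha3
    have : (b3 * z s ^ q + k3) * z s ^ 1 + k = b3 * z s ^ (q + 1) + (k3 * z s + k) := by ring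
    rw [this]
    exact Submodule.add_mem_sup (Ideal.mul_mem_left _ _ (Ideal.mem_span_singleton_self _))
      (Ideal.add_mem _ (Ideal.mul_mem_right _ _ hk3) hk)

/-- colon by a monomial -/
theorem colonMon {R ι : Type*} [CommRing R] [Fintype ι] (z : ι → R)
    (H : ∀ (T : Finset ι) (j : ι), j ∉ T → ∀ c, z j * c ∈ Ideal.span (z '' T) → c ∈ Ideal.span (z '' T))
    (a : ι → ℕ) : ∀ c, c * ∏ i, z i ^ a i ∈ Ideal.span (Set.range fun i => z i ^ (a i + 1)) →
      c ∈ Ideal.span (Set.range z) := by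
  classical
  induction hN : ∑ i, a i generalizing a with
  | zero =>
    intro c hc
    have : ∀ i, a i = 0 := by simpa using hN
    simpa [this] using hc
  | succ N ih =>
    intro c hc
    obtain ⟨s, hs⟩ : ∃ s, a s ≠ 0 := by
      by_contra h
      push Not at h
      simp [h] at hN
    obtain ⟨q, hq⟩ := Nat.exists_eq_succ_of_ne_zero hs
    rw [Nat.succ_eq_add_one] at hq
    set a' := Function.update a s q with ha'
    have ha's : a' s = q := Function.update_self ..
    have ha'i : ∀ i, i ≠ s → a' i = a i := fun i hi => Function.update_of_ne hi _ _
    have e1 : ∑ i, a i = ∑ i, a' i + 1 := by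
      rw [← Finset.add_sum_erase _ _ (Finset.mem_univ s), ← Finset.add_sum_erase _ a' (Finset.mem_univ s), hq, ha's,
        Finset.sum_congr rfl (fun i hi => (ha'i i (Finset.ne_of_mem_erase hi)).symm)]
      ring
    have e2 : ∏ i, z i ^ a i = z s * ∏ i, z i ^ a' i := by
      rw [← Finset.mul_prod_erase _ _ (Finset.mem_univ s), ← Finset.mul_prod_erase _ (fun i => z i ^ a' i) (Finset.mem_univ s), hq, ha's,
        Finset.prod_congr rfl (fun i hi => by rw [← ha'i i (Finset.ne_of_mem_erase hi)])]
      ring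
    refine ih a' (by omega) c ?_
    set K := Ideal.span ((fun i => z i ^ (a i + 1)) '' (Finset.univ.erase s : Finset ι)) with hK
    have hsplit : ∀ p : ι → ℕ, (∀ i, i ≠ s → p i = a i) →
        Ideal.span (Set.range fun i => z i ^ (p i + 1)) = Ideal.span {z s ^ (p s + 1)} ⊔ K := by
      intro p hp
      rw [hK, ← Ideal.span_union]
      congr 1
      ext t
      simp only [Set.mem_image, Set.mem_union, Set.mem_singleton_iff, Finset.coe_erase, Set.mem_range]
      constructor
      · rintro ⟨i, rfl⟩
        by_cases his : i = s
        · subst his; left; rfl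
        · right; exact ⟨i, ⟨by simp, his⟩, by rw [hp i his]⟩
      · rintro (rfl | ⟨i, ⟨hi, his⟩, rfl⟩)
        · exact ⟨s, rfl⟩
        · exact ⟨i, by rw [hp i his]⟩
    rw [hsplit a (fun _ _ => rfl), e2, hq] at hc
    rw [hsplit a' ha'i, ha's]
    obtain ⟨a2, ha2, k2, hk2, e3⟩ := Submodule.mem_sup.1 hc
    obtain ⟨b, rfl⟩ := Ideal.mem_span_singleton'.1 ha2
    have h3 : c * ∏ i, z i ^ a' i - b * z s ^ (q + 1) ∈ K := by
      apply powReg z H _ (Finset.univ.erase s) (fun i => a i + 1) (by simp) le_rfl s (by simp)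
      have : z s * (c * ∏ i, z i ^ a' i - b * z s ^ (q + 1)) = k2 := by linear_combination -e3
      rw [this]
      exact hk2
    have : c * ∏ i, z i ^ a' i = b * z s ^ (q + 1) + (c * ∏ i, z i ^ a' i - b * z s ^ (q + 1)) := by ring
    rw [this]
    exact Submodule.add_mem_sup (Ideal.mul_mem_left _ _ (Ideal.mem_span_singleton_self _)) h3

/-- monomials in a finite family -/
def monz {σ : Type*} [Fintype σ] (z : σ → R) (a : σ →₀ ℕ) : R := ∏ i, z i ^ a i

/-- weights -/
def wtz {σ : Type*} [Fintype σ] (w : σ → ℝ) (a : σ →₀ ℕ) : ℝ := ∑ i, (a i : ℝ) * w i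

theorem monz_add {σ : Type*} [Fintype σ] (z : σ → R) (a b : σ →₀ ℕ) :
    monz z (a + b) = monz z a * monz z b := by
  simp [monz, pow_add, Finset.prod_mul_distrib]

theorem wtz_add {σ : Type*} [Fintype σ] (w : σ → ℝ) (a b : σ →₀ ℕ) :
    wtz w (a + b) = wtz w a + wtz w b := by
  simp [wtz, add_mul, Finset.sum_add_distrib]

/-- monomials of weight at least `t` -/
def Iz {σ : Type*} [Fintype σ] (z : σ → R) (w : σ → ℝ) (t : ℝ) : Ideal R :=
  Ideal.span {g | ∃ a : σ →₀ ℕ, g = monz z a ∧ t ≤ wtz w a}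

/-- monomials of weight larger than `t` -/
def Gz {σ : Type*} [Fintype σ] (z : σ → R) (w : σ → ℝ) (t : ℝ) : Ideal R :=
  Ideal.span {g | ∃ a : σ →₀ ℕ, g = monz z a ∧ t < wtz w a}

theorem Iz_mul {σ : Type*} [Fintype σ] (z : σ → R) (w : σ → ℝ) (s t : ℝ) :
    Iz z w s * Iz z w t ≤ Iz z w (s + t) := by
  rw [Iz, Iz, Ideal.span_mul_span', Ideal.span_le]
  rintro _ ⟨_, ⟨a, rfl, ha⟩, _, ⟨b, rfl, hb⟩, rfl⟩
  exact Ideal.subset_span ⟨a + b, (monz_add z a b).symm, by rw [wtz_add]; linarith⟩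

theorem Iz_mul_Gz {σ : Type*} [Fintype σ] (z : σ → R) (w : σ → ℝ) (s t : ℝ) :
    Iz z w s * Gz z w t ≤ Gz z w (s + t) := by
  rw [Iz, Gz, Ideal.span_mul_span', Ideal.span_le]
  rintro _ ⟨_, ⟨a, rfl, ha⟩, _, ⟨b, rfl, hb⟩, rfl⟩
  exact Ideal.subset_span ⟨a + b, (monz_add z a b).symm, by rw [wtz_add]; linarith⟩

theorem Iz_zero {σ : Type*} [Fintype σ] (z : σ → R) (w : σ → ℝ) : Iz z w 0 = ⊤ := by
  rw [Ideal.eq_top_iff_one]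
  exact Ideal.subset_span ⟨0, by simp [monz], by simp [wtz]⟩

theorem Gz_of_lt {σ : Type*} [Fintype σ] (z : σ → R) (w : σ → ℝ) {s t : ℝ} (h : s < t) :
    Iz z w t ≤ Gz z w s := by
  apply Ideal.span_mono
  rintro _ ⟨a, rfl, ha⟩
  exact ⟨a, rfl, h.trans_le ha⟩

/-- weighted quasi-regularity -/
theorem quasiReg {σ : Type*} [Fintype σ] (z : σ → R) (w : σ → ℝ) (hw : ∀ s, 0 < w s)
    (Hcol : ∀ a : σ → ℕ, ∀ c, c * ∏ i, z i ^ a i ∈ Ideal.span (Set.range fun i => z i ^ (a i + 1)) →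
      c ∈ Ideal.span (Set.range z)) (t : ℝ) (A : Finset (σ →₀ ℕ)) (hA : ∀ a ∈ A, wtz w a = t)
    (c : (σ →₀ ℕ) → R) (h : ∑ a ∈ A, c a * monz z a ∈ Gz z w t) (a : σ →₀ ℕ) (ha : a ∈ A) :
    c a ∈ Ideal.span (Set.range z) := by
  classical
  apply Hcol a
  have key : ∀ b : σ →₀ ℕ, b ≠ a → t ≤ wtz w b →
      monz z b ∈ Ideal.span (Set.range fun i => z i ^ (a i + 1)) := by
    intro b hba hb
    obtain ⟨i, hi⟩ : ∃ i, a i < b i := by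
      by_contra hcon
      push Not at hcon
      obtain ⟨j, hj⟩ : ∃ j, b j ≠ a j := by
        by_contra h'
        push Not at h'
        exact hba (Finsupp.ext h')
      have : wtz w b < wtz w a := by
        apply Finset.sum_lt_sum
        · intro i _
          exact mul_le_mul_of_nonneg_right (by exact_mod_cast hcon i) (hw i).le
        · exact ⟨j, Finset.mem_univ _, mul_lt_mul_of_pos_right
            (by exact_mod_cast lt_of_le_of_ne (hcon j) hj) (hw j)⟩
      rw [hA a ha] at this
      linarith
    have hdvd : z i ^ (a i + 1) ∣ monz z b :=
      (pow_dvd_pow _ hi).trans (Finset.dvd_prod_of_mem (fun i => z i ^ b i) (Finset.mem_univ i))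
    exact Ideal.mem_of_dvd _ hdvd (Ideal.subset_span ⟨i, rfl⟩)
  have e : c a * ∏ i, z i ^ a i = (∑ a ∈ A, c a * monz z a) - ∑ b ∈ A.erase a, c b * monz z b := by
    rw [← Finset.add_sum_erase _ _ ha]; simp [monz]
  rw [e]
  refine Ideal.sub_mem _ ?_ (Ideal.sum_mem _ fun b hb => ?_)
  · refine (Ideal.span_le.2 ?_) h
    rintro _ ⟨b, rfl, hb⟩
    refine key b ?_ hb.le
    rintro rfl
    exact hb.ne (hA b ha).symm
  · exact Ideal.mul_mem_left _ _ (key b (Finset.ne_of_mem_erase hb) (hA b (Finset.mem_of_mem_erase hb)).ge)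

section core
variable {d : ℕ} {y : R} {u : Fin d → R} {l : ℝ} {Lr : Fin d → ℝ} {σ : Type*} [Fintype σ]
  {z : σ → R} {w : σ → ℝ}

theorem rees_single_mem {t : ℝ} {x : R} (h : x ∈ monIdeal y u l Lr t) :
    AddMonoidAlgebra.single t x ∈ ReesAlgebra y u l Lr :=
  Algebra.subset_adjoin ⟨t, x, h, rfl⟩

theorem grIdeal_single_mem {t t' : ℝ} {x : R} (h : x ∈ monIdeal y u l Lr t') (ht : t < t')
    (hm : AddMonoidAlgebra.single t x ∈ ReesAlgebra y u l Lr) :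
    (⟨AddMonoidAlgebra.single t x, hm⟩ : ReesAlgebra y u l Lr) ∈ grIdeal y u l Lr :=
  Ideal.subset_span ⟨t, x, ⟨t', ht, h⟩, rfl⟩

theorem rees_coeff (hI : ∀ t, monIdeal y u l Lr t = Iz z w t) {p : AddMonoidAlgebra R ℝ} (hp : p ∈ ReesAlgebra y u l Lr) :
    ∀ t, p.coeff t ∈ Iz z w t := by
  classical
  induction hp using Algebra.adjoin_induction with
  | mem x hx =>
    obtain ⟨s, x, hx, rfl⟩ := hx
    intro t
    rw [hI] at hx
    rw [AddMonoidAlgebra.coeff_single, Finsupp.single_apply]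
    split_ifs with h
    · exact h ▸ hx
    · exact Ideal.zero_mem _
  | algebraMap r =>
    intro t
    rw [AddMonoidAlgebra.coe_algebraMap, Function.comp_apply, AddMonoidAlgebra.coeff_single, Finsupp.single_apply]
    split_ifs with h
    · rw [← h, Iz_zero]; trivial
    · exact Ideal.zero_mem _
  | add x y _ _ hx hy =>
    intro t
    rw [AddMonoidAlgebra.coeff_add]
    exact Ideal.add_mem _ (hx t) (hy t)
  | mul x y _ _ hx hy =>
    intro t
    rw [AddMonoidAlgebra.coeff_mul]
    refine Ideal.sum_mem _ fun a _ => Ideal.sum_mem _ fun b _ => ?_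
    dsimp only
    split_ifs with h
    · exact h ▸ Iz_mul z w a b (Ideal.mul_mem_mul (hx a) (hy b))
    · exact Ideal.zero_mem _

theorem grIdeal_coeff (hI : ∀ t, monIdeal y u l Lr t = Iz z w t) {p : ReesAlgebra y u l Lr} (hp : p ∈ grIdeal y u l Lr) :
    ∀ t, (p : AddMonoidAlgebra R ℝ).coeff t ∈ Gz z w t := by
  classical
  induction hp using Submodule.span_induction with
  | mem p hp =>
    obtain ⟨s, x, ⟨s', hs, hx⟩, hp⟩ := hp
    intro t
    rw [hI] at hx
    rw [hp, AddMonoidAlgebra.coeff_single, Finsupp.single_apply]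
    split_ifs with h
    · exact h ▸ Gz_of_lt z w hs hx
    · exact Ideal.zero_mem _
  | zero => intro t; exact Ideal.zero_mem _
  | add x y _ _ hx hy =>
    intro t
    rw [Subalgebra.coe_add, AddMonoidAlgebra.coeff_add]
    exact Ideal.add_mem _ (hx t) (hy t)
  | smul q p _ hp =>
    intro t
    rw [smul_eq_mul, Subalgebra.coe_mul, AddMonoidAlgebra.coeff_mul]
    refine Ideal.sum_mem _ fun a _ => Ideal.sum_mem _ fun b _ => ?_
    dsimp only
    split_ifs with h
    · exact h ▸ Iz_mul_Gz z w a b (Ideal.mul_mem_mul (rees_coeff hI q.2 a) (hp b))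
    · exact Ideal.zero_mem _

theorem gen_mem (hI : ∀ t, monIdeal y u l Lr t = Iz z w t) (s : σ) : AddMonoidAlgebra.single (w s) (z s) ∈ ReesAlgebra y u l Lr := by
  classical
  apply rees_single_mem
  rw [hI]
  refine Ideal.subset_span ⟨Finsupp.single s 1, ?_, ?_⟩
  · simp [monz, Finsupp.single_apply, Finset.prod_ite_eq]
  · simp [wtz, Finsupp.single_apply]

/-- the map to the Rees algebra -/
def phi0 (hI : ∀ t, monIdeal y u l Lr t = Iz z w t) :
    MvPolynomial σ R →ₐ[R] ReesAlgebra y u l Lr :=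
  MvPolynomial.aeval fun s => ⟨AddMonoidAlgebra.single (w s) (z s), gen_mem hI s⟩

theorem phi0_monomial (hI : ∀ t, monIdeal y u l Lr t = Iz z w t) (a : σ →₀ ℕ) (c : R) :
    (phi0 hI (MvPolynomial.monomial a c) : AddMonoidAlgebra R ℝ) =
      AddMonoidAlgebra.single (wtz w a) (c * monz z a) := by
  classical
  rw [phi0, MvPolynomial.aeval_monomial, Finsupp.prod_fintype _ _ (by simp)]
  rw [Subalgebra.coe_mul, Subalgebra.coe_algebraMap, SubmonoidClass.coe_finsetProd]
  simp only [Subalgebra.coe_pow, AddMonoidAlgebra.single_pow, nsmul_eq_mul]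
  rw [AddMonoidAlgebra.prod_single, AddMonoidAlgebra.coe_algebraMap, Function.comp_apply,
    AddMonoidAlgebra.single_mul_single, zero_add]
  rfl

theorem phi0_coeff (hI : ∀ t, monIdeal y u l Lr t = Iz z w t) (p : MvPolynomial σ R) (t : ℝ) :
    (phi0 hI p : AddMonoidAlgebra R ℝ).coeff t =
      ∑ a ∈ p.support with wtz w a = t, p.coeff a * monz z a := by
  classical
  conv_lhs => rw [p.as_sum, map_sum]
  rw [AddSubmonoidClass.coe_finsetSum, AddMonoidAlgebra.coeff_sum, Finsupp.finsetSum_apply,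
    Finset.sum_filter]
  refine Finset.sum_congr rfl fun a _ => ?_
  rw [phi0_monomial, AddMonoidAlgebra.coeff_single, Finsupp.single_apply]

theorem phi_surj (hI : ∀ t, monIdeal y u l Lr t = Iz z w t) : Function.Surjective
    ((Ideal.Quotient.mk (grIdeal y u l Lr)).comp (phi0 hI : MvPolynomial σ R →+* _)) := by
  classical
  set φ := (Ideal.Quotient.mk (grIdeal y u l Lr)).comp (phi0 hI : MvPolynomial σ R →+* _) with hφ
  intro q
  obtain ⟨⟨p, hp⟩, rfl⟩ := Ideal.Quotient.mk_surjective q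
  induction hp using Algebra.adjoin_induction with
  | mem x hx =>
    obtain ⟨t, x, hx, rfl⟩ := hx
    have hx' := hx
    rw [hI] at hx'
    have : ∀ h : AddMonoidAlgebra.single t x ∈ ReesAlgebra y u l Lr,
        ∃ a, φ a = Ideal.Quotient.mk (grIdeal y u l Lr) ⟨AddMonoidAlgebra.single t x, h⟩ := by
      clear hx
      induction hx' using Submodule.span_induction with
      | mem x hx =>
        obtain ⟨a, rfl, ha⟩ := hx
        intro h
        rcases ha.eq_or_lt with rfl | ha
        · refine ⟨MvPolynomial.monomial a 1, ?_⟩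
          rw [hφ, RingHom.comp_apply]
          congr 1
          apply Subtype.ext
          erw [phi0_monomial hI a 1]
          rw [one_mul]
        · refine ⟨0, ?_⟩
          rw [map_zero, eq_comm, Ideal.Quotient.eq_zero_iff_mem]
          refine grIdeal_single_mem (t' := wtz w a) ?_ ha h
          rw [hI]
          exact Ideal.subset_span ⟨a, rfl, le_rfl⟩
      | zero =>
        intro h
        refine ⟨0, ?_⟩
        rw [map_zero, eq_comm, Ideal.Quotient.eq_zero_iff_mem]
        have : (⟨AddMonoidAlgebra.single t 0, h⟩ : ReesAlgebra y u l Lr) = 0 :=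
          Subtype.ext (AddMonoidAlgebra.single_zero _)
        rw [this]; exact Ideal.zero_mem _
      | add x y hx hy ihx ihy =>
        intro h
        have h1 := rees_single_mem (y := _) (u := _) (l := l) (Lr := Lr) (t := t) (x := x) (by rw [hI]; exact hx)
        have h2 := rees_single_mem (y := _) (u := _) (l := l) (Lr := Lr) (t := t) (x := y) (by rw [hI]; exact hy)
        obtain ⟨a, ha⟩ := ihx h1
        obtain ⟨b, hb⟩ := ihy h2
        refine ⟨a + b, ?_⟩
        rw [map_add, ha, hb, ← map_add]
        congr 1
        exact Subtype.ext (AddMonoidAlgebra.single_add _ _ _).symm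
      | smul r x hx ihx =>
        intro h
        have h1 := rees_single_mem (y := _) (u := _) (l := l) (Lr := Lr) (t := t) (x := x) (by rw [hI]; exact hx)
        obtain ⟨a, ha⟩ := ihx h1
        refine ⟨MvPolynomial.C r * a, ?_⟩
        rw [map_mul, ha, hφ, RingHom.comp_apply, ← map_mul]
        congr 1
        apply Subtype.ext
        rw [Subalgebra.coe_mul]
        have : ((phi0 hI : MvPolynomial σ R →+* ReesAlgebra y u l Lr) (MvPolynomial.C r) : AddMonoidAlgebra R ℝ) = AddMonoidAlgebra.single 0 r := by
          have := phi0_monomial hI 0 r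
          simpa [monz, wtz] using this
        rw [this, AddMonoidAlgebra.single_mul_single, zero_add]
        rfl
    exact this _
  | algebraMap r =>
    refine ⟨MvPolynomial.C r, ?_⟩
    rw [hφ, RingHom.comp_apply]
    congr 1
    exact (phi0 hI).commutes r
  | add x y hx hy ihx ihy =>
    obtain ⟨a, ha⟩ := ihx
    obtain ⟨b, hb⟩ := ihy
    exact ⟨a + b, by rw [map_add, ha, hb, ← map_add]; rfl⟩
  | mul x y hx hy ihx ihy =>
    obtain ⟨a, ha⟩ := ihx
    obtain ⟨b, hb⟩ := ihy
    exact ⟨a * b, by rw [map_mul, ha, hb, ← map_mul]; rfl⟩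

theorem phi_ker (hI : ∀ t, monIdeal y u l Lr t = Iz z w t) (hw : ∀ s, 0 < w s)
    (Hcol : ∀ a : σ → ℕ, ∀ c, c * ∏ i, z i ^ a i ∈ Ideal.span (Set.range fun i => z i ^ (a i + 1)) →
      c ∈ Ideal.span (Set.range z)) (J : Ideal R) (hJ : J = Ideal.span (Set.range z)) :
    RingHom.ker ((Ideal.Quotient.mk (grIdeal y u l Lr)).comp (phi0 hI : MvPolynomial σ R →+* _)) =
      RingHom.ker (MvPolynomial.map (σ := σ) (Ideal.Quotient.mk J)) := by
  classical
  apply le_antisymm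
  · intro p hp
    rw [RingHom.mem_ker, RingHom.comp_apply, Ideal.Quotient.eq_zero_iff_mem] at hp
    rw [RingHom.mem_ker]
    ext a
    rw [MvPolynomial.coeff_map, MvPolynomial.coeff_zero, Ideal.Quotient.eq_zero_iff_mem]
    by_cases ha : a ∈ p.support
    · rw [hJ]
      have h := grIdeal_coeff hI hp (wtz w a)
      erw [phi0_coeff hI p] at h
      exact quasiReg z w hw Hcol (wtz w a) _ (fun b hb => (Finset.mem_filter.1 hb).2) _ h a
        (Finset.mem_filter.2 ⟨ha, rfl⟩)
    · rw [MvPolynomial.notMem_support_iff.1 ha]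
      exact Ideal.zero_mem _
  · rw [MvPolynomial.ker_map, Ideal.mk_ker, hJ, Ideal.map_span, Ideal.span_le]
    rintro _ ⟨_, ⟨s, rfl⟩, rfl⟩
    rw [SetLike.mem_coe, RingHom.mem_ker, RingHom.comp_apply, Ideal.Quotient.eq_zero_iff_mem]
    refine Ideal.subset_span ⟨0, z s, ⟨w s, hw s, ?_⟩, ?_⟩
    · rw [hI]
      refine Ideal.subset_span ⟨Finsupp.single s 1, ?_, ?_⟩
      · simp [monz, Finsupp.single_apply, Finset.prod_ite_eq]
      · simp [wtz, Finsupp.single_apply]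
    · have := phi0_monomial hI 0 (z s)
      simp only [MvPolynomial.monomial_zero', monz, wtz, Finsupp.coe_zero, Pi.zero_apply, pow_zero,
        Finset.prod_const_one, mul_one, Nat.cast_zero, zero_mul, Finset.sum_const_zero] at this
      exact this

theorem grCore (hI : ∀ t, monIdeal y u l Lr t = Iz z w t) (hw : ∀ s, 0 < w s)
    (Hcol : ∀ a : σ → ℕ, ∀ c, c * ∏ i, z i ^ a i ∈ Ideal.span (Set.range fun i => z i ^ (a i + 1)) →
      c ∈ Ideal.span (Set.range z)) (J : Ideal R) (hJ : J = Ideal.span (Set.range z)) :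
    ∃ e : GrRing y u l Lr ≃+* MvPolynomial σ (R ⧸ J),
      (∀ r : R, e (algebraMap R (GrRing y u l Lr) r) = MvPolynomial.C (Ideal.Quotient.mk J r)) ∧
      (∀ s, e (Ideal.Quotient.mk (grIdeal y u l Lr)
        ⟨AddMonoidAlgebra.single (w s) (z s), gen_mem hI s⟩) = MvPolynomial.X s) := by
  set φ := (Ideal.Quotient.mk (grIdeal y u l Lr)).comp (phi0 hI : MvPolynomial σ R →+* _) with hφ
  have hs : Function.Surjective φ := phi_surj hI
  have hk : RingHom.ker φ = RingHom.ker (MvPolynomial.map (σ := σ) (Ideal.Quotient.mk J)) :=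
    phi_ker hI hw Hcol J hJ
  let e := ((RingHom.quotientKerEquivOfSurjective hs).symm.trans (Ideal.quotEquivOfEq hk)).trans
    (RingHom.quotientKerEquivOfSurjective (MvPolynomial.map_surjective _ (Ideal.Quotient.mk_surjective (I := J))))
  have he : ∀ p, e (φ p) = MvPolynomial.map (Ideal.Quotient.mk J) p := by
    intro p
    have : (RingHom.quotientKerEquivOfSurjective hs).symm (φ p) = Ideal.Quotient.mk _ p := by
      rw [RingEquiv.symm_apply_eq]; rfl
    simp only [e, RingEquiv.trans_apply, this]
    rfl
  refine ⟨e, ?_, ?_⟩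
  · intro r
    have : algebraMap R (GrRing y u l Lr) r = φ (MvPolynomial.C r) := by
      rw [hφ, RingHom.comp_apply]
      have h2 : (phi0 hI : MvPolynomial σ R →+* ReesAlgebra y u l Lr) (MvPolynomial.C r) =
          algebraMap R (ReesAlgebra y u l Lr) r :=
        (phi0 hI).commutes r
      rw [h2]; rfl
    rw [this, he, MvPolynomial.map_C]
  · intro s
    have : Ideal.Quotient.mk (grIdeal y u l Lr)
        ⟨AddMonoidAlgebra.single (w s) (z s), gen_mem hI s⟩ = φ (MvPolynomial.X s) := by
      rw [hφ, RingHom.comp_apply]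
      congr 1
      exact (MvPolynomial.aeval_X (fun s => (⟨AddMonoidAlgebra.single (w s) (z s), gen_mem hI s⟩ :
        ReesAlgebra y u l Lr)) s).symm
    rw [this, he, MvPolynomial.map_X]

end core

theorem monIdeal_eq {d : ℕ} (y : R) (u : Fin d → R) (L : Fin d → ℚ) (hL0 : ∀ i, 0 ≤ L i) (l : ℝ) (t : ℝ) :
    monIdeal y u l (fun i => (L i : ℝ)) t =
      Iz (σ := Option {i : Fin d // 0 < L i}) (fun o => o.elim y (fun i => u i.1))
        (fun o => o.elim l (fun i => (L i.1 : ℝ))) t := by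
  classical
  have hz : ∀ i : {i : Fin d // ¬ 0 < L i}, (L i.1 : ℝ) = 0 := by
    intro i
    have := le_antisymm (not_lt.1 i.2) (hL0 i.1)
    rw [this]; simp
  apply le_antisymm
  · refine Ideal.span_le.2 ?_
    rintro _ ⟨ab, rfl, hab⟩
    let a : Option {i : Fin d // 0 < L i} →₀ ℕ :=
      Finsupp.equivFunOnFinite.symm (fun o => o.elim ab.2 (fun i => ab.1 i.1))
    have hm : monz (fun o : Option {i : Fin d // 0 < L i} => o.elim y (fun i => u i.1)) a ∣ monomial y u ab := by
      rw [monz, Fintype.prod_option, monomial,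
        ← Fintype.prod_subtype_mul_prod_subtype (fun i => 0 < L i)]
      simp only [a, Finsupp.equivFunOnFinite_symm_apply_apply, Option.elim]
      rw [← mul_assoc]
      exact Dvd.intro _ rfl
    have hwt : wtz (fun o : Option {i : Fin d // 0 < L i} => o.elim l (fun i => (L i.1 : ℝ))) a =
        weight l (fun i => (L i : ℝ)) ab := by
      rw [wtz, Fintype.sum_option, weight,
        ← Fintype.sum_subtype_add_sum_subtype (fun i => 0 < L i)]
      simp [a, hz, mul_comm]
    exact Ideal.mem_of_dvd _ hm (Ideal.subset_span ⟨a, rfl, by rw [hwt]; exact hab⟩)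
  · refine Ideal.span_le.2 ?_
    rintro _ ⟨a, rfl, ha⟩
    refine Ideal.subset_span ⟨(fun i => if h : 0 < L i then a (some ⟨i, h⟩) else 0, a none), ?_, ?_⟩
    · rw [monz, Fintype.prod_option, monomial,
        ← Fintype.prod_subtype_mul_prod_subtype (fun i => 0 < L i)]
      have h1 : ∀ i : {i : Fin d // 0 < L i}, 0 < L i.1 := fun i => i.2
      have h2 : ∀ i : {i : Fin d // ¬ 0 < L i}, ¬ 0 < L i.1 := fun i => i.2
      simp [h1, h2, -not_lt]
    · rw [wtz, Fintype.sum_option] at ha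
      rw [weight, ← Fintype.sum_subtype_add_sum_subtype (fun i => 0 < L i)]
      have h1 : ∀ i : {i : Fin d // 0 < L i}, 0 < L i.1 := fun i => i.2
      have h2 : ∀ i : {i : Fin d // ¬ 0 < L i}, ¬ 0 < L i.1 := fun i => i.2
      simpa [h1, h2, hz, -not_lt, mul_comm] using ha

theorem ellOf_nonneg {d : ℕ} [IsLocalRing R] (f y : R) (u : Fin d → R) (L : Fin d → ℚ)
    (hL0 : ∀ i, 0 ≤ L i) : 0 ≤ ellOf L (Delta f y u) := by
  apply Real.sInf_nonneg
  rintro _ ⟨x, hx, rfl⟩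
  have hx0 : x ∈ orthant d := by
    refine Set.mem_sInter.1 hx _ ⟨⟨subset_rfl, ?_, ?_, ?_⟩, ?_⟩
    · have : orthant d = Set.Ici (0 : Fin d → ℝ) := rfl
      rw [this]; exact isClosed_Ici
    · have : orthant d = Set.Ici (0 : Fin d → ℝ) := rfl
      rw [this]; exact convex_Ici _
    · intro v hv w hw i
      exact add_nonneg (hv i) (hw i)
    · intro p hp i
      simp only [Set.mem_iUnion] at hp
      obtain ⟨c, _, ab, _, hlt, rfl⟩ := hp
      have : (ab.2 : ℝ) < (ordRes f u : ℝ) := by exact_mod_cast hlt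
      exact div_nonneg (Nat.cast_nonneg _) (by linarith)
  exact Finset.sum_nonneg fun i _ => mul_nonneg (by exact_mod_cast hL0 i) (hx0 i)

/-- **Proposition I.3 (i).** If `l := min L(Δ(f; u; y)) ≠ 0`, the associated graded
ring of `R` w.r.t. the monomial valuation `v_{L,u,y,f}` is the polynomial ring
`(R/(y, {u_i}_{i ∈ I}))[Y, {U_i}_{i ∈ I}]`, `I = {i : λ_i > 0}`, with `Y = in y`
and `U_i = in u_i`. -/
theorem grRing_of_ell_ne_zero
    {d : ℕ} (R : Type u) [CommRing R] [IsLocalRing R]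
    (hreg : IsRegularLocalRing R) (y : R) (u : Fin d → R) (hrsp : IsRSP R y u)
    (f : R) (hfM : f ∈ maximalIdeal R) (hfu : f ∉ Ideal.span (Set.range u))
    (L : Fin d → ℚ) (hL0 : ∀ i, 0 ≤ L i) (hLne : L ≠ 0)
    (Lr : Fin d → ℝ) (hLr : Lr = fun i => (L i : ℝ))
    (l : ℝ) (hl : l = ellOf L (Delta f y u)) (hlne : l ≠ 0) :
    ∃ e : GrRing y u l Lr ≃+*
        MvPolynomial (Option {i : Fin d // 0 < L i})
          (R ⧸ Ideal.span (insert y {x | ∃ i, 0 < L i ∧ x = u i})),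
      (∀ r : R, e (algebraMap R (GrRing y u l Lr) r)
          = MvPolynomial.C (Ideal.Quotient.mk
              (Ideal.span (insert y {x | ∃ i, 0 < L i ∧ x = u i})) r)) ∧
      (∃ hy : AddMonoidAlgebra.single l y ∈ ReesAlgebra y u l Lr,
        e (Ideal.Quotient.mk (grIdeal y u l Lr) ⟨AddMonoidAlgebra.single l y, hy⟩)
          = MvPolynomial.X none) ∧
      (∀ (i : Fin d) (hi : 0 < L i),
        ∃ hui : AddMonoidAlgebra.single (Lr i) (u i) ∈ ReesAlgebra y u l Lr,
          e (Ideal.Quotient.mk (grIdeal y u l Lr)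
              ⟨AddMonoidAlgebra.single (Lr i) (u i), hui⟩)
            = MvPolynomial.X (some ⟨i, hi⟩)) := by
  classical
  have hl0 : 0 < l := lt_of_le_of_ne (hl ▸ ellOf_nonneg f y u L hL0) hlne.symm
  subst hLr
  have hN : IsNoetherianRing R := hreg.1
  obtain ⟨hspan, hdim⟩ := hrsp
  let g : Option {i : Fin d // 0 < L i} → Fin (d + 1) := fun o => o.elim 0 (fun i => i.1.succ)
  have hg : Function.Injective g := by
    rintro (_ | i) (_ | j) h
    · rfl
    · exact absurd h.symm (Fin.succ_ne_zero _)
    · exact absurd h (Fin.succ_ne_zero _)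
    · rw [Subtype.ext (Fin.succ_injective _ h)]
  let z : Option {i : Fin d // 0 < L i} → R := fun o => o.elim y (fun i => u i.1)
  let zz : Fin (d + 1) → R := Fin.cons y u
  have hzg : ∀ s, z s = zz (g s) := by
    rintro (_ | i)
    · rfl
    · simp [z, zz, g]
  have H : ∀ (T : Finset (Option {i : Fin d // 0 < L i})) (j), j ∉ T →
      ∀ c, z j * c ∈ Ideal.span (z '' T) → c ∈ Ideal.span (z '' T) := by
    intro T j hj c hc
    have e : z '' T = zz '' (T.image g : Finset _) := by
      rw [Finset.coe_image, Set.image_image]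
      exact Set.image_congr fun s _ => hzg s
    rw [e] at hc ⊢
    refine ((quotDomain zz hspan hdim (T.image g)).mem_or_mem hc).resolve_left ?_
    rw [hzg]
    refine notMemSpan zz hspan hdim _ _ ?_
    intro h
    obtain ⟨k, hk, hkj⟩ := Finset.mem_image.1 h
    exact hj (hg hkj ▸ hk)
  have hI := monIdeal_eq y u L hL0 l
  have hJ : Ideal.span (insert y {x | ∃ i, 0 < L i ∧ x = u i}) = Ideal.span (Set.range z) := by
    congr 1
    ext x
    constructor
    · rintro (rfl | ⟨i, hi, rfl⟩)
      · exact ⟨none, rfl⟩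
      · exact ⟨some ⟨i, hi⟩, rfl⟩
    · rintro ⟨_ | i, rfl⟩
      · exact Or.inl rfl
      · exact Or.inr ⟨i.1, i.2, rfl⟩
  obtain ⟨e, he1, he2⟩ := grCore hI (by
    rintro (_ | i)
    · exact hl0
    · have := i.2
      simpa using this) (colonMon z H) _ hJ
  exact ⟨e, he1, ⟨gen_mem hI none, he2 none⟩,
    fun i hi => ⟨gen_mem hI (some ⟨i, hi⟩), he2 (some ⟨i, hi⟩)⟩⟩

end CharPolyhedra
end
end

section
/- Let (R,M,k) be a regular local ring with regular system of parameters (y,u_1,...,u_d), f ∈ M with f ∉ (u_1,...,u_d), and L(x_1,...,x_d) = λ_1x_1+···+λ_dx_d a nonzero linear form with λ_i ∈ ℚ_{≥0}. Set I := {i : λ_i > 0} and l := l(f,u,y) = min{L(a) : a ∈ Δ(f;u;y)}. If l = 0, then the associated graded ring of R with respect to the monomial valuation v_{L,u,y,f} is gr_{v}(R) = (R/({u_i}_{i∈I}))[{U_i}_{i∈I}], a polynomial ring over R/({u_i}_{i∈I}) in the variables U_i = in u_i, i ∈ I. -/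
/-!
Characteristic polyhedra of singularities without completion
(V. Cossart, O. Piltant), formalized statements.
-/

noncomputable section

open IsLocalRing TensorProduct

namespace CharPolyhedra

universe u v

/-! ### Monomial expansions and polyhedra -/

variable {R : Type u} [CommRing R]

lemma quot_aux {R : Type u} [CommRing R] [IsLocalRing R] [IsNoetherianRing R]
    (T S : Finset R) (h : Ideal.span ((T : Set R) ∪ S) = maximalIdeal R) :
    ∃ _ : IsLocalRing (R ⧸ Ideal.span (T : Set R)),
      Ideal.span (Ideal.Quotient.mk (Ideal.span (T : Set R)) '' S)
        = maximalIdeal (R ⧸ Ideal.span (T : Set R)) ∧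
      ringKrullDim R ≤ ringKrullDim (R ⧸ Ideal.span (T : Set R)) + T.card := by
  have hT : Ideal.span (T : Set R) ≤ maximalIdeal R := by
    rw [← h]; exact Ideal.span_mono Set.subset_union_left
  have hne : Ideal.span (T : Set R) ≠ ⊤ := fun h' => by
    rw [h', top_le_iff] at hT
    exact (maximalIdeal.isMaximal R).ne_top hT
  have : Nontrivial (R ⧸ Ideal.span (T : Set R)) := Ideal.Quotient.nontrivial_iff.mpr hne
  have hloc : IsLocalRing (R ⧸ Ideal.span (T : Set R)) :=
    IsLocalRing.of_surjective' _ Ideal.Quotient.mk_surjective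
  refine ⟨hloc, ?_, ?_⟩
  · have h1 : (maximalIdeal R).map (Ideal.Quotient.mk (Ideal.span (T : Set R)))
        = maximalIdeal (R ⧸ Ideal.span (T : Set R)) := by
      refine ((Ideal.map_eq_top_or_isMaximal_of_surjective _ Ideal.Quotient.mk_surjective
        (maximalIdeal.isMaximal R)).resolve_left ?_) |> IsLocalRing.eq_maximalIdeal
      intro h2
      have := Ideal.comap_map_of_surjective' _
        (Ideal.Quotient.mk_surjective (I := Ideal.span (T : Set R))) (maximalIdeal R)
      rw [h2, Ideal.comap_top, Ideal.mk_ker, sup_eq_left.mpr hT] at this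
      exact (maximalIdeal.isMaximal R).ne_top this.symm
    rw [← h1, ← h, Ideal.span_union, Ideal.map_sup, Ideal.map_quotient_self, bot_sup_eq,
      Ideal.map_span]
  · apply ringKrullDim_le_ringKrullDim_quotient_add_card
    rw [IsLocalRing.ringJacobson_eq_maximalIdeal]
    exact Ideal.span_le.mp hT

lemma isDomain_aux (n : ℕ) : ∀ (R : Type u) [CommRing R] [IsLocalRing R] [IsNoetherianRing R]
    (S : Finset R), Ideal.span (S : Set R) = maximalIdeal R → S.card ≤ n →
    (n : WithBot ℕ∞) ≤ ringKrullDim R → IsDomain R := by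
  classical
  induction n with
  | zero =>
    intro R _ _ _ S hS hc _
    have : S = ∅ := by simpa using hc
    subst this
    have hb : maximalIdeal R = ⊥ := by rw [← hS]; simp
    have : IsField R := (IsLocalRing.isField_iff_maximalIdeal_eq).mpr hb
    exact this.isDomain
  | succ n ih =>
    intro R _ _ _ S hS hc hdim
    have hpos : ¬ ringKrullDim R ≤ 0 := fun h => by
      have := hdim.trans h
      norm_cast at this
    have h1 : ¬ maximalIdeal R ≤ maximalIdeal R * maximalIdeal R := fun h => by
      have hb : maximalIdeal R = ⊥ :=
        Submodule.eq_bot_of_le_smul_of_le_jacobson_bot (maximalIdeal R) (maximalIdeal R)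
          (IsNoetherian.noetherian _) h (IsLocalRing.maximalIdeal_le_jacobson _)
      apply hpos
      have := ringKrullDim_le_spanFinrank_maximalIdeal R
      rw [hb] at this
      simpa using this
    have h2 : ∀ p ∈ minimalPrimes R, ¬ maximalIdeal R ≤ p := fun p hp h => by
      have hpp : p.IsPrime := hp.1.1
      have : p = maximalIdeal R := le_antisymm (IsLocalRing.le_maximalIdeal hpp.ne_top) h
      apply hpos
      rw [← IsLocalRing.maximalIdeal_height_eq_ringKrullDim]
      rw [this] at hp
      rw [Ideal.height_eq_zero_iff.mpr hp]
      rfl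
    have hfin : (minimalPrimes R).Finite := minimalPrimes.finite_of_isNoetherianRing R
    obtain ⟨x, hxM, hx⟩ : ∃ x ∈ maximalIdeal R, x ∉ maximalIdeal R * maximalIdeal R ∧
        ∀ p ∈ minimalPrimes R, x ∉ p := by
      by_contra! hcon
      have := (Ideal.subset_union_prime (s := insert (maximalIdeal R * maximalIdeal R) hfin.toFinset)
        (f := id) (maximalIdeal R * maximalIdeal R) (maximalIdeal R * maximalIdeal R)
        (by
          intro i hi hne _
          have : i ∈ minimalPrimes R := by simpa [hne] using hi
          exact this.1.1) (I := maximalIdeal R)).mp (by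
          intro x hx
          by_cases hx2 : x ∈ maximalIdeal R * maximalIdeal R
          · simp [hx2]
          · obtain ⟨p, hp, hxp⟩ := hcon x hx hx2
            simp only [Finset.coe_insert, Set.mem_iUnion]
            exact ⟨p, by simp [hp], hxp⟩)
      obtain ⟨i, hi, hle⟩ := this
      rcases Finset.mem_insert.mp hi with rfl | hi
      · exact h1 hle
      · exact h2 i (by simpa using hi) hle
    obtain ⟨hx2, hxp⟩ := hx
    -- exchange
    obtain ⟨s0, hs0, hgen⟩ : ∃ s0 ∈ S,
        Ideal.span ((({x} : Finset R) : Set R) ∪ ((S.erase s0 : Finset R) : Set R)) = maximalIdeal R := by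
      have hxS : x ∈ Ideal.span (S : Set R) := hS ▸ hxM
      obtain ⟨c, -, hcx⟩ := Submodule.mem_span_finset.mp hxS
      have : ∃ s0 ∈ S, IsUnit (c s0) := by
        by_contra! hcon
        apply hx2
        rw [← hcx]
        refine Ideal.sum_mem _ fun s hs => ?_
        refine Ideal.mul_mem_mul ((IsLocalRing.mem_maximalIdeal _).mpr (hcon s hs)) ?_
        rw [← hS]; exact Ideal.subset_span hs
      obtain ⟨s0, hs0, hu⟩ := this
      refine ⟨s0, hs0, le_antisymm ?_ ?_⟩
      · rw [Ideal.span_le]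
        rintro z (hz | hz)
        · have : z = x := by simpa using hz
          rw [this]; exact hxM
        · rw [SetLike.mem_coe, ← hS]
          exact Ideal.subset_span (Finset.mem_of_mem_erase hz)
      · rw [← hS, Ideal.span_le]
        intro z hz
        set K := Ideal.span ((({x} : Finset R) : Set R) ∪ ((S.erase s0 : Finset R) : Set R))
        have hK : ∀ w ∈ S.erase s0, w ∈ K := fun w hw => Ideal.subset_span (Or.inr hw)
        have hxK : x ∈ K := Ideal.subset_span (Or.inl (by simp))
        by_cases hz0 : z = s0
        · subst hz0
          rw [← Finset.add_sum_erase _ _ hs0] at hcx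
          have h3 : c z * z ∈ K := by
            have : c z * z = x - ∑ a ∈ S.erase z, c a • a := by
              rw [← hcx]; simp
            rw [this]
            exact K.sub_mem hxK (K.sum_mem fun w hw => K.mul_mem_left _ (hK w hw))
          exact (Ideal.unit_mul_mem_iff_mem K hu).mp h3
        · exact hK z (Finset.mem_erase.mpr ⟨hz0, hz⟩)
    obtain ⟨hloc, hmax, hd⟩ := quot_aux {x} (S.erase s0) hgen
    have hdom : IsDomain (R ⧸ Ideal.span ((({x} : Finset R) : Set R))) := by
      refine ih _ ((S.erase s0).image (Ideal.Quotient.mk _)) (by rw [Finset.coe_image]; exact hmax) ?_ ?_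
      · refine Finset.card_image_le.trans ?_
        rw [Finset.card_erase_of_mem hs0]; omega
      · have := hdim.trans hd
        rw [Finset.card_singleton] at this
        push_cast at this
        exact ENat.WithBot.add_le_add_one_right_iff.mp (by simpa using this)
    rw [Finset.coe_singleton] at hdom
    have hpr : (Ideal.span {x}).IsPrime := (Ideal.Quotient.isDomain_iff_prime _).mp hdom
    obtain ⟨p, hp, hple⟩ := Ideal.exists_minimalPrimes_le (I := (⊥ : Ideal R)) (J := Ideal.span {x}) bot_le
    have hpp : p.IsPrime := hp.1.1
    have hpb : p = ⊥ := by
      refine Submodule.eq_bot_of_le_smul_of_le_jacobson_bot (maximalIdeal R) p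
          (IsNoetherian.noetherian _) ?_ (IsLocalRing.maximalIdeal_le_jacobson _)
      intro z hz
      obtain ⟨q, rfl⟩ := Ideal.mem_span_singleton'.mp (hple hz)
      have hq : q ∈ p := (hpp.mem_or_mem hz).resolve_right (hxp p hp)
      rw [mul_comm]
      exact Ideal.mul_mem_mul hxM hq
    rw [hpb] at hpp
    exact IsDomain.of_bot_isPrime R


/-- Every member is a nonzerodivisor modulo the ideal generated by any others. -/
def RegFam {R : Type u} [CommRing R] {ι : Type} (u : ι → R) : Prop :=
  ∀ (T : Finset ι) (i : ι), i ∉ T → ∀ r, u i * r ∈ Ideal.span (u '' T) → r ∈ Ideal.span (u '' T)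

lemma regFam_of_sop {R : Type u} [CommRing R] [IsLocalRing R] [IsNoetherianRing R] {n : ℕ}
    (s : Fin n → R) (hs : Ideal.span (Set.range s) = maximalIdeal R)
    (hd : ringKrullDim R = n) : RegFam s := by
  classical
  intro T i hi r hr
  have hun : (((T.image s : Finset R) : Set R) ∪ ((Tᶜ.image s : Finset R) : Set R)) = Set.range s := by
    rw [← Finset.coe_union, ← Finset.image_union, Finset.union_compl]
    simp
  obtain ⟨hloc, hmax, hdim⟩ := quot_aux (T.image s) (Tᶜ.image s) (by rw [hun, hs])
  have hle : T.card ≤ n := by simpa using Finset.card_le_univ T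
  have hdom : IsDomain (R ⧸ Ideal.span ((T.image s : Finset R) : Set R)) := by
    refine isDomain_aux (n - T.card) _ ((Tᶜ.image s).image (Ideal.Quotient.mk _))
      (by rw [← hmax]; congr 1; exact Finset.coe_image ..) ?_ ?_
    · refine Finset.card_image_le.trans (Finset.card_image_le.trans ?_)
      rw [Finset.card_compl]; simp
    · have h1 : ((n - T.card : ℕ) : WithBot ℕ∞) + (T.card : ℕ) ≤
          ringKrullDim (R ⧸ Ideal.span ((T.image s : Finset R) : Set R)) + (T.card : ℕ) := by
        rw [← Nat.cast_add, Nat.sub_add_cancel hle, ← hd]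
        refine hdim.trans ?_
        gcongr
        exact_mod_cast Finset.card_image_le
      exact ENat.WithBot.add_le_add_natCast_right_iff.mp h1
  rw [Finset.coe_image] at hdom
  have hpr : (Ideal.span (s '' T)).IsPrime := (Ideal.Quotient.isDomain_iff_prime _).mp hdom
  refine (hpr.mem_or_mem hr).resolve_left fun hmem => ?_
  have hM : maximalIdeal R = Submodule.span R (s '' ((Finset.univ.erase i : Finset (Fin n)) : Set (Fin n))) := by
    rw [← hs]
    refine le_antisymm (Ideal.span_le.mpr ?_) (Ideal.span_mono (Set.image_subset_range _ _))
    rintro _ ⟨j, rfl⟩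
    by_cases hj : j = i
    · subst hj
      refine Ideal.span_mono (Set.image_mono ?_) hmem
      intro k hk
      have : k ≠ j := fun h => hi (h ▸ hk)
      simpa using this
    · exact Ideal.subset_span ⟨j, by simpa using hj, rfl⟩
  have h1 := ringKrullDim_le_spanFinrank_maximalIdeal R
  have h2 := Submodule.spanFinrank_span_le_ncard_of_finite (R := R)
    (s := s '' ((Finset.univ.erase i : Finset (Fin n)) : Set (Fin n))) (Set.toFinite _)
  rw [← hM] at h2
  have h3 : (s '' ((Finset.univ.erase i : Finset (Fin n)) : Set (Fin n))).ncard ≤ n - 1 := by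
    refine (Set.ncard_image_le (Set.toFinite _)).trans ?_
    rw [Set.ncard_coe_finset, Finset.card_erase_of_mem (Finset.mem_univ _)]; simp
  rw [hd] at h1
  have h4 : n ≤ (maximalIdeal R).spanFinrank := by exact_mod_cast h1
  have := i.pos
  omega

lemma nzd_pow_aux {R : Type u} [CommRing R] (K : Ideal R) (x a : R)
    (ha : ∀ r, a * r ∈ K → r ∈ K)
    (hx : ∀ r, x * r ∈ K ⊔ Ideal.span {a} → r ∈ K ⊔ Ideal.span {a}) (n : ℕ) :
    ∀ r, x * r ∈ K ⊔ Ideal.span {a ^ n} → r ∈ K ⊔ Ideal.span {a ^ n} := by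
  have mem : ∀ (b z : R), z ∈ K ⊔ Ideal.span {b} ↔ ∃ t, z - t * b ∈ K := by
    intro b z
    rw [Submodule.mem_sup]
    constructor
    · rintro ⟨k, hk, w, hw, rfl⟩
      obtain ⟨t, rfl⟩ := Ideal.mem_span_singleton'.mp hw
      exact ⟨t, by simpa using hk⟩
    · rintro ⟨t, ht⟩
      exact ⟨_, ht, t * b, Ideal.mem_span_singleton'.mpr ⟨t, rfl⟩, by ring⟩
  have han : ∀ n r, a ^ n * r ∈ K → r ∈ K := by
    intro n
    induction n with
    | zero => intro r h; simpa using h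
    | succ n ih => intro r h; rw [pow_succ, mul_assoc] at h; exact ha _ (ih _ h)
  induction n with
  | zero => intro r _; simp
  | succ n ih =>
    intro r hr
    obtain ⟨s, hs⟩ := (mem _ _).mp hr
    obtain ⟨t, ht⟩ := (mem _ _).mp (ih r ((mem _ _).mpr ⟨s * a, by
      convert hs using 1; ring⟩))
    have h1 : a ^ n * (x * t - s * a) ∈ K := by
      have := K.sub_mem hs (K.mul_mem_left x ht)
      convert this using 1; ring
    obtain ⟨w, hw⟩ := (mem _ _).mp (hx t ((mem _ _).mpr ⟨s, han n _ h1⟩))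
    refine (mem _ _).mpr ⟨w, ?_⟩
    have := K.add_mem ht (K.mul_mem_left (a ^ n) hw)
    convert this using 1; ring

lemma RegFam.nzd_pow {R : Type u} [CommRing R] {ι : Type} [DecidableEq ι] {u : ι → R} (hu : RegFam u)
    (n : ι → ℕ) (B : Finset ι) :
    ∀ (A : Finset ι), Disjoint A B → ∀ i, i ∉ A → i ∉ B → ∀ r,
      u i * r ∈ Ideal.span (u '' A) ⊔ Ideal.span ((fun j => u j ^ n j) '' B) →
      r ∈ Ideal.span (u '' A) ⊔ Ideal.span ((fun j => u j ^ n j) '' B) := by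
  induction B using Finset.induction_on with
  | empty =>
    intro A _ i hiA _ r hr
    simpa using hu A i hiA r (by simpa using hr)
  | insert j B hj ih =>
    intro A hAB i hiA hiB
    rw [Finset.disjoint_insert_right] at hAB
    simp only [Finset.mem_insert, not_or] at hiB
    have e1 : Ideal.span (u '' A) ⊔ Ideal.span ((fun j => u j ^ n j) '' (insert j B : Finset ι))
        = (Ideal.span (u '' A) ⊔ Ideal.span ((fun j => u j ^ n j) '' B)) ⊔ Ideal.span {u j ^ n j} := by
      rw [Finset.coe_insert, Set.image_insert_eq, Ideal.span_insert, sup_assoc, sup_comm (Ideal.span {_})]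
    rw [e1]
    apply nzd_pow_aux
    · exact ih A hAB.2 j hAB.1 hj
    · have e2 : (Ideal.span (u '' A) ⊔ Ideal.span ((fun j => u j ^ n j) '' B)) ⊔ Ideal.span {u j}
          = Ideal.span (u '' (insert j A : Finset ι)) ⊔ Ideal.span ((fun j => u j ^ n j) '' B) := by
        rw [Finset.coe_insert, Set.image_insert_eq, Ideal.span_insert, sup_comm, sup_assoc]
      rw [e2]
      refine ih (insert j A) ?_ i ?_ hiB.2
      · rw [Finset.disjoint_insert_left]; exact ⟨hj, hAB.2⟩
      · simp [hiA, hiB.1]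

lemma RegFam.colon_aux {R : Type u} [CommRing R] {ι : Type} [DecidableEq ι] {u : ι → R} (hu : RegFam u)
    (n : ι → ℕ) (B : Finset ι) :
    ∀ (A : Finset ι), Disjoint A B → ∀ c,
      c * ∏ j ∈ B, u j ^ n j ∈
        Ideal.span (u '' A) ⊔ Ideal.span ((fun j => u j ^ (n j + 1)) '' B) →
      c ∈ Ideal.span (u '' (A ∪ B : Finset ι)) := by
  induction B using Finset.induction_on with
  | empty =>
    intro A _ c hr
    simpa using hr
  | insert j B hj ih =>
    intro A hAB c hc
    rw [Finset.disjoint_insert_right] at hAB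
    set K := Ideal.span (u '' A) ⊔ Ideal.span ((fun j => u j ^ (n j + 1)) '' B) with hK
    have e1 : Ideal.span (u '' A) ⊔ Ideal.span ((fun j => u j ^ (n j + 1)) '' (insert j B : Finset ι))
        = K ⊔ Ideal.span {u j ^ (n j + 1)} := by
      rw [Finset.coe_insert, Set.image_insert_eq, Ideal.span_insert, hK, sup_assoc,
        sup_comm (Ideal.span {_})]
    rw [e1, Submodule.mem_sup] at hc
    obtain ⟨k, hk, w, hw, hkw⟩ := hc
    obtain ⟨t, rfl⟩ := Ideal.mem_span_singleton'.mp hw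
    rw [Finset.prod_insert hj] at hkw
    have hnz : ∀ m r, u j ^ m * r ∈ K → r ∈ K := by
      intro m
      induction m with
      | zero => intro r h; simpa using h
      | succ m ih' =>
        intro r h
        rw [pow_succ, mul_assoc] at h
        exact hu.nzd_pow (fun j => n j + 1) B A hAB.2 j hAB.1 hj r (ih' _ h)
    have h1 : c * ∏ j ∈ B, u j ^ n j - t * u j ∈ K := by
      apply hnz (n j)
      convert hk using 1
      linear_combination -hkw
    have h2 : (insert j A ∪ B : Finset ι) = A ∪ insert j B := by
      ext; simp
    rw [← h2]
    refine ih (insert j A) ?_ c ?_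
    · rw [Finset.disjoint_insert_left]; exact ⟨hj, hAB.2⟩
    · have e2 : Ideal.span (u '' (insert j A : Finset ι)) ⊔ Ideal.span ((fun j => u j ^ (n j + 1)) '' B)
          = Ideal.span {u j} ⊔ K := by
        rw [Finset.coe_insert, Set.image_insert_eq, Ideal.span_insert, hK, sup_assoc]
      rw [e2, Submodule.mem_sup]
      exact ⟨t * u j, Ideal.mem_span_singleton'.mpr ⟨t, rfl⟩, _, h1, by ring⟩

lemma RegFam.comp {R : Type u} [CommRing R] {ι κ : Type} {u : ι → R} (hu : RegFam u)
    (g : κ → ι) (hg : Function.Injective g) : RegFam (u ∘ g) := by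
  classical
  intro T i hi r hr
  have : (u ∘ g) '' T = u '' (T.image g : Finset ι) := by
    rw [Finset.coe_image, Set.image_comp]
  rw [this] at hr ⊢
  refine hu (T.image g) (g i) ?_ r hr
  simpa [hg.eq_iff] using hi

/-- The colon statement for a finite regular family. -/
lemma RegFam.colon {R : Type u} [CommRing R] {ι : Type} [Fintype ι] {u : ι → R} (hu : RegFam u)
    (n : ι → ℕ) (c : R)
    (h : c * ∏ j, u j ^ n j ∈ Ideal.span (Set.range fun j => u j ^ (n j + 1))) :
    c ∈ Ideal.span (Set.range u) := by
  classical
  have := hu.colon_aux n Finset.univ ∅ (by simp) c (by simpa using h)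
  simpa using this


section grHelpers
variable {d : ℕ} (y : R) (u : Fin d → R) (w : Fin d → ℝ)

lemma monIdeal_mono {lam mu : ℝ} (h : lam ≤ mu) : monIdeal y u 0 w mu ≤ monIdeal y u 0 w lam := by
  apply Ideal.span_mono
  rintro g ⟨ab, rfl, hab⟩
  exact ⟨ab, rfl, h.trans hab⟩

lemma monomial_mem (ab : (Fin d → ℕ) × ℕ) {lam : ℝ} (h : lam ≤ weight 0 w ab) :
    monomial y u ab ∈ monIdeal y u 0 w lam := Ideal.subset_span ⟨ab, rfl, h⟩

lemma monIdeal_mul {lam mu : ℝ} {x z : R} (hx : x ∈ monIdeal y u 0 w lam)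
    (hz : z ∈ monIdeal y u 0 w mu) : x * z ∈ monIdeal y u 0 w (lam + mu) := by
  have h := Ideal.mul_mem_mul hx hz
  unfold monIdeal at h
  rw [Ideal.span_mul_span] at h
  refine Ideal.span_mono ?_ h
  rintro _ ⟨_, ⟨p, rfl, hp⟩, _, ⟨q, rfl, hq⟩, rfl⟩
  refine ⟨(p.1 + q.1, p.2 + q.2), ?_, ?_⟩
  · simp only [monomial, Pi.add_apply, pow_add, Finset.prod_mul_distrib]; ring
  · have : weight 0 w (p.1 + q.1, p.2 + q.2) = weight 0 w p + weight 0 w q := by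
      simp [weight, mul_add, Finset.sum_add_distrib]
    rw [this]; exact add_le_add hp hq

lemma one_mem_monIdeal : (1 : R) ∈ monIdeal y u 0 w 0 := by
  have := monomial_mem y u w (0, 0) (lam := 0) (by simp [weight])
  simpa [monomial] using this

lemma u_mem_monIdeal (i : Fin d) : u i ∈ monIdeal y u 0 w (w i) := by
  classical
  have := monomial_mem y u w (Pi.single i 1, 0) (lam := w i) (by simp [weight, Pi.single_apply])
  simpa [monomial, Pi.single_apply, Finset.prod_ite_eq, pow_ite] using this

/-- Homogeneous elements of the Rees algebra. -/
def reesSet : Set (AddMonoidAlgebra R ℝ) := {p | ∃ (lam : ℝ) (x : R), x ∈ monIdeal y u 0 w lam ∧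
    p = AddMonoidAlgebra.single lam x}

/-- Homogeneous elements of the ideal. -/
def grSet : Set (AddMonoidAlgebra R ℝ) :=
  {p | ∃ (lam : ℝ) (x : R), (∃ lam' > lam, x ∈ monIdeal y u 0 w lam') ∧
    p = AddMonoidAlgebra.single lam x}

lemma single_mem_rees {lam : ℝ} {x : R} (h : x ∈ monIdeal y u 0 w lam) :
    AddMonoidAlgebra.single lam x ∈ ReesAlgebra y u 0 w := Algebra.subset_adjoin ⟨lam, x, h, rfl⟩

lemma rees_le : Subalgebra.toSubmodule (ReesAlgebra y u 0 w) ≤ Submodule.span R (reesSet y u w) := by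
  unfold ReesAlgebra
  rw [Algebra.adjoin_eq_span]
  apply Submodule.span_mono
  intro p hp
  induction hp using Submonoid.closure_induction with
  | mem p hp => exact hp
  | one => exact ⟨0, 1, one_mem_monIdeal y u w, rfl⟩
  | mul p q _ _ hp hq =>
    obtain ⟨a, x, hx, rfl⟩ := hp
    obtain ⟨b, z, hz, rfl⟩ := hq
    exact ⟨a + b, x * z, monIdeal_mul y u w hx hz, by simp⟩

lemma gr_le (p : ReesAlgebra y u 0 w) (hp : p ∈ grIdeal y u 0 w) :
    (p : AddMonoidAlgebra R ℝ) ∈ Submodule.span R (grSet y u w) := by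
  unfold grIdeal at hp
  induction hp using Submodule.span_induction with
  | mem p hp =>
    obtain ⟨lam, x, h, hp⟩ := hp
    exact Submodule.subset_span ⟨lam, x, h, hp⟩
  | zero => exact Submodule.zero_mem _
  | add p q _ _ hp hq => exact Submodule.add_mem _ hp hq
  | smul a p _ hp =>
    have ha : (a : AddMonoidAlgebra R ℝ) ∈ Submodule.span R (reesSet y u w) := rees_le y u w a.2
    have := Submodule.mul_mem_mul ha hp
    rw [Submodule.span_mul_span] at this
    refine Submodule.span_mono ?_ this
    rintro _ ⟨_, ⟨a, x, hx, rfl⟩, _, ⟨b, z, ⟨b', hb, hz⟩, rfl⟩, rfl⟩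
    exact ⟨a + b, x * z, ⟨a + b', by linarith, monIdeal_mul y u w hx hz⟩, by simp⟩

lemma gr_coeff (p : AddMonoidAlgebra R ℝ) (hp : p ∈ Submodule.span R (grSet y u w)) (lam : ℝ) :
    ∃ lam' > lam, p.coeff lam ∈ monIdeal y u 0 w lam' := by
  induction hp using Submodule.span_induction with
  | mem p hp =>
    obtain ⟨mu, x, ⟨mu', hmu, hx⟩, rfl⟩ := hp
    rw [AddMonoidAlgebra.coeff_single]
    by_cases h : mu = lam
    · subst h; exact ⟨mu', hmu, by simpa using hx⟩
    · exact ⟨lam + 1, by linarith, by rw [Finsupp.single_eq_of_ne (Ne.symm h)]; exact Ideal.zero_mem _⟩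
  | zero => exact ⟨lam + 1, by linarith, Ideal.zero_mem _⟩
  | add p q _ _ hp hq =>
    obtain ⟨a, ha, hp⟩ := hp
    obtain ⟨b, hb, hq⟩ := hq
    refine ⟨min a b, lt_min ha hb, ?_⟩
    rw [AddMonoidAlgebra.coeff_add]
    exact Ideal.add_mem _ (monIdeal_mono y u w (min_le_left _ _) hp)
      (monIdeal_mono y u w (min_le_right _ _) hq)
  | smul a p _ hp =>
    obtain ⟨b, hb, hp⟩ := hp
    exact ⟨b, hb, by rw [AddMonoidAlgebra.coeff_smul]; exact Ideal.mul_mem_left _ _ hp⟩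

variable (P : Fin d → Prop) [DecidablePred P]

/-- The evaluation `X_i ↦ u_i T^{w_i}` into the Rees algebra. -/
def phi : MvPolynomial {i // P i} R →ₐ[R] ReesAlgebra y u 0 w :=
  MvPolynomial.aeval fun i => ⟨AddMonoidAlgebra.single (w i) (u i),
    single_mem_rees y u w (u_mem_monIdeal y u w i)⟩

lemma phi_X (i : {i // P i}) : phi y u w P (MvPolynomial.X i) =
    ⟨AddMonoidAlgebra.single (w i) (u i), single_mem_rees y u w (u_mem_monIdeal y u w i)⟩ := by
  rw [phi, MvPolynomial.aeval_X]

lemma prod_single {ι : Type} (s : Finset ι) (a : ι → ℝ) (r : ι → R) :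
    ∏ i ∈ s, AddMonoidAlgebra.single (a i) (r i) = AddMonoidAlgebra.single (∑ i ∈ s, a i) (∏ i ∈ s, r i) := by
  classical
  induction s using Finset.induction_on with
  | empty => simp [AddMonoidAlgebra.one_def]
  | insert i s hi ih => simp [Finset.prod_insert hi, Finset.sum_insert hi, ih]

lemma phi_monomial (a : {i // P i} →₀ ℕ) (c : R) :
    ((phi y u w P (MvPolynomial.monomial a c) : ReesAlgebra y u 0 w) : AddMonoidAlgebra R ℝ)
      = AddMonoidAlgebra.single (∑ i : {i // P i}, w i * a i) (c * ∏ i : {i // P i}, u i ^ a i) := by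
  have h : (ReesAlgebra y u 0 w).val.comp (phi y u w P) =
      MvPolynomial.aeval fun i : {i // P i} => AddMonoidAlgebra.single (w i) (u i) := by
    apply MvPolynomial.algHom_ext
    intro i
    rw [AlgHom.comp_apply, phi, MvPolynomial.aeval_X, MvPolynomial.aeval_X]
    rfl
  refine (DFunLike.congr_fun h (MvPolynomial.monomial a c)).trans ?_
  rw [MvPolynomial.aeval_monomial, Finsupp.prod_fintype _ _ (by simp), ← Algebra.smul_def]
  simp only [AddMonoidAlgebra.single_pow, prod_single, AddMonoidAlgebra.smul_single, smul_eq_mul,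
    nsmul_eq_mul, mul_comm]

end grHelpers

section grHelpers2
variable {d : ℕ} (y : R) (u : Fin d → R) (w : Fin d → ℝ)
variable (P : Fin d → Prop) [DecidablePred P]

lemma exists_lt_of_weight (hP : ∀ i, P i ↔ 0 < w i) (a a0 : {i // P i} → ℕ) (hne : a ≠ a0)
    (h : ∑ i : {i // P i}, w i * a0 i ≤ ∑ i : {i // P i}, w i * a i) : ∃ i, a0 i + 1 ≤ a i := by
  by_contra! hcon
  obtain ⟨j, hj⟩ := Function.ne_iff.mp hne
  refine absurd h (not_le.mpr (Finset.sum_lt_sum (fun i _ => ?_) ⟨j, Finset.mem_univ _, ?_⟩))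
  · have h1 : a i ≤ a0 i := by have := hcon i; omega
    exact mul_le_mul_of_nonneg_left (by exact_mod_cast h1) ((hP i).mp i.2).le
  · have h1 : a j < a0 j := by have := hcon j; omega
    exact mul_lt_mul_of_pos_left (by exact_mod_cast h1) ((hP j).mp j.2)

lemma weight_eq (hP : ∀ i, P i ↔ 0 < w i) (hw : ∀ i, 0 ≤ w i) (ab : (Fin d → ℕ) × ℕ) :
    weight 0 w ab = ∑ i : {i // P i}, w i * ab.1 i := by
  rw [weight, zero_mul, zero_add, ← Fintype.sum_subtype_add_sum_subtype P]
  rw [add_eq_left]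
  refine Finset.sum_eq_zero fun i _ => ?_
  have : w i = 0 := le_antisymm (not_lt.mp fun h => i.2 ((hP i).mpr h)) (hw i)
  simp [this]

lemma monomial_eq (ab : (Fin d → ℕ) × ℕ) :
    monomial y u ab = (y ^ ab.2 * ∏ i : {i // ¬ P i}, u i ^ ab.1 i) * ∏ i : {i // P i}, u i ^ ab.1 i := by
  rw [monomial, ← Fintype.prod_subtype_mul_prod_subtype P]
  ring

lemma prod_mem_powIdeal (a a0 : {i // P i} → ℕ) (h : ∃ i, a0 i + 1 ≤ a i) :
    ∏ i : {i // P i}, u i ^ a i ∈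
      Ideal.span (Set.range fun j : {i // P i} => u j ^ (a0 j + 1)) := by
  obtain ⟨i, hi⟩ := h
  refine Ideal.mem_of_dvd _ ?_ (Ideal.subset_span ⟨i, rfl⟩)
  exact (pow_dvd_pow _ hi).trans (Finset.dvd_prod_of_mem (fun i : {i // P i} => u i ^ a i) (Finset.mem_univ i))

lemma phi_inj_aux (hP : ∀ i, P i ↔ 0 < w i) (hw : ∀ i, 0 ≤ w i) (hu : RegFam u)
    (p : MvPolynomial {i // P i} R) (hp : phi y u w P p ∈ grIdeal y u 0 w)
    (a0 : {i // P i} →₀ ℕ) :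
    MvPolynomial.coeff a0 p ∈ Ideal.span (Set.range fun i : {i // P i} => u i) := by
  classical
  by_cases ha0 : a0 ∈ p.support
  swap
  · rw [MvPolynomial.notMem_support_iff.mp ha0]; exact Ideal.zero_mem _
  set K := Ideal.span (Set.range fun j : {i // P i} => u j ^ (a0 j + 1)) with hK
  obtain ⟨lam', hlam, hmem⟩ := gr_coeff y u w _ (gr_le y u w _ hp) (∑ i : {i // P i}, w i * a0 i)
  have hIK : monIdeal y u 0 w lam' ≤ K := by
    refine Ideal.span_le.mpr ?_
    rintro _ ⟨ab, rfl, hab⟩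
    rw [weight_eq w P hP hw] at hab
    rw [SetLike.mem_coe, monomial_eq y u P]
    refine K.mul_mem_left _ (prod_mem_powIdeal u P (fun i => ab.1 i) a0
      (exists_lt_of_weight w P hP (fun i => ab.1 i) a0 ?_ (hlam.le.trans hab)))
    intro h
    rw [← h] at hlam
    exact absurd (hlam.trans_le hab) (lt_irrefl _)
  have h1 := hIK hmem
  have h2 : MvPolynomial.coeff a0 p * ∏ i : {i // P i}, u i ^ a0 i ∈ K := by
    have hcoe : ((phi y u w P p : ReesAlgebra y u 0 w) : AddMonoidAlgebra R ℝ) =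
        ∑ a ∈ p.support, AddMonoidAlgebra.single (∑ i : {i // P i}, w i * a i)
          (MvPolynomial.coeff a p * ∏ i : {i // P i}, u i ^ a i) := by
      conv_lhs => rw [← MvPolynomial.support_sum_monomial_coeff p]
      rw [map_sum]
      exact (map_sum (ReesAlgebra y u 0 w).val _ _).trans
        (Finset.sum_congr rfl fun a _ => phi_monomial y u w P a _)
    rw [hcoe, AddMonoidAlgebra.coeff_sum, Finsupp.finsetSum_apply,
      ← Finset.add_sum_erase _ _ ha0] at h1
    simp only [AddMonoidAlgebra.coeff_single, Finsupp.single_eq_same] at h1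
    refine (Ideal.add_mem_iff_left K (K.sum_mem fun a ha => ?_)).mp h1
    rw [Finsupp.single_apply]
    split_ifs with h
    · refine K.mul_mem_left _ (prod_mem_powIdeal u P a a0
        (exists_lt_of_weight w P hP a a0 ?_ h.ge))
      exact fun h => (Finset.ne_of_mem_erase ha) (DFunLike.coe_injective h)
    · exact K.zero_mem
  exact (hu.comp (Subtype.val : {i // P i} → Fin d) Subtype.val_injective).colon a0 _ h2

/-- The composite to the graded ring. -/
def psi : MvPolynomial {i // P i} R →ₐ[R] GrRing y u 0 w :=
  (Ideal.Quotient.mkₐ R (grIdeal y u 0 w)).comp (phi y u w P)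

lemma mk_single_mem (hP : ∀ i, P i ↔ 0 < w i) (hw : ∀ i, 0 ≤ w i) (lam : ℝ) (x : R)
    (hx : x ∈ monIdeal y u 0 w lam) :
    Ideal.Quotient.mkₐ R (grIdeal y u 0 w) ⟨AddMonoidAlgebra.single lam x, single_mem_rees y u w hx⟩
      ∈ (psi y u w P).range := by
  have hx' := hx
  unfold monIdeal at hx'
  induction hx' using Submodule.span_induction with
  | mem x h =>
    obtain ⟨ab, rfl, hab⟩ := h
    rcases hab.lt_or_eq with h | h
    · have h0 : Ideal.Quotient.mkₐ R (grIdeal y u 0 w)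
          ⟨AddMonoidAlgebra.single lam _, single_mem_rees y u w hx⟩ = 0 := by
        refine Ideal.Quotient.eq_zero_iff_mem.mpr (Ideal.subset_span ?_)
        exact ⟨lam, _, ⟨_, h, monomial_mem y u w ab le_rfl⟩, rfl⟩
      rw [h0]; exact Subalgebra.zero_mem _
    · refine ⟨MvPolynomial.monomial (Finsupp.equivFunOnFinite.symm fun i : {i // P i} => ab.1 i)
        (y ^ ab.2 * ∏ i : {i // ¬ P i}, u i ^ ab.1 i), ?_⟩
      refine congrArg (Ideal.Quotient.mkₐ R (grIdeal y u 0 w)) (Subtype.ext ?_)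
      refine (phi_monomial y u w P _ _).trans ?_
      simp only [Finsupp.equivFunOnFinite_symm_apply_apply]
      rw [← monomial_eq, ← weight_eq w P hP hw, ← h]
  | zero =>
    have : (⟨AddMonoidAlgebra.single lam 0, single_mem_rees y u w hx⟩ : ReesAlgebra y u 0 w) = 0 :=
      Subtype.ext (by simp)
    rw [this, map_zero]; exact Subalgebra.zero_mem _
  | add a b ha hb iha ihb =>
    have : (⟨AddMonoidAlgebra.single lam (a + b), single_mem_rees y u w hx⟩ : ReesAlgebra y u 0 w)
        = ⟨AddMonoidAlgebra.single lam a, single_mem_rees y u w ha⟩ +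
          ⟨AddMonoidAlgebra.single lam b, single_mem_rees y u w hb⟩ :=
      Subtype.ext (by simp)
    rw [this, map_add]; exact Subalgebra.add_mem _ (iha ha) (ihb hb)
  | smul r a ha iha =>
    have : (⟨AddMonoidAlgebra.single lam (r • a), single_mem_rees y u w hx⟩ : ReesAlgebra y u 0 w)
        = r • ⟨AddMonoidAlgebra.single lam a, single_mem_rees y u w ha⟩ :=
      Subtype.ext (by simp)
    rw [this, map_smul]; exact Subalgebra.smul_mem _ (iha ha) r

lemma psi_surjective (hP : ∀ i, P i ↔ 0 < w i) (hw : ∀ i, 0 ≤ w i) :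
    Function.Surjective (psi y u w P) := by
  intro z
  obtain ⟨⟨q, hq⟩, rfl⟩ := Ideal.Quotient.mk_surjective z
  change Ideal.Quotient.mkₐ R (grIdeal y u 0 w) ⟨q, hq⟩ ∈ (psi y u w P).range
  have hq' := rees_le y u w hq
  have hS : reesSet y u w ⊆ ((((psi y u w P).range.comap
      (Ideal.Quotient.mkₐ R (grIdeal y u 0 w))).map (ReesAlgebra y u 0 w).val :
        Subalgebra R (AddMonoidAlgebra R ℝ)) : Set (AddMonoidAlgebra R ℝ)) := by
    rintro _ ⟨lam, x, hx, rfl⟩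
    exact ⟨⟨_, single_mem_rees y u w hx⟩, mk_single_mem y u w P hP hw lam x hx, rfl⟩
  obtain ⟨q', h1, h2⟩ := (Submodule.span_le (p := Subalgebra.toSubmodule (((psi y u w P).range.comap
      (Ideal.Quotient.mkₐ R (grIdeal y u 0 w))).map (ReesAlgebra y u 0 w).val))).mpr hS hq'
  have : q' = ⟨q, hq⟩ := Subtype.ext h2
  rw [← this]; exact h1

end grHelpers2
/-- **Proposition I.3 (ii).** If `l := min L(Δ(f; u; y)) = 0`, the associated graded
ring of `R` w.r.t. the monomial valuation `v_{L,u,y,f}` is the polynomial ring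
`(R/({u_i}_{i ∈ I}))[{U_i}_{i ∈ I}]`, `I = {i : λ_i > 0}`, with `U_i = in u_i`. -/
theorem grRing_of_ell_eq_zero
    {d : ℕ} (R : Type u) [CommRing R] [IsLocalRing R]
    (hreg : IsRegularLocalRing R) (y : R) (u : Fin d → R) (hrsp : IsRSP R y u)
    (f : R) (hfM : f ∈ maximalIdeal R) (hfu : f ∉ Ideal.span (Set.range u))
    (L : Fin d → ℚ) (hL0 : ∀ i, 0 ≤ L i) (hLne : L ≠ 0)
    (Lr : Fin d → ℝ) (hLr : Lr = fun i => (L i : ℝ))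
    (l : ℝ) (hl : l = ellOf L (Delta f y u)) (hl0 : l = 0) :
    ∃ e : GrRing y u l Lr ≃+*
        MvPolynomial {i : Fin d // 0 < L i}
          (R ⧸ Ideal.span {x | ∃ i, 0 < L i ∧ x = u i}),
      (∀ r : R, e (algebraMap R (GrRing y u l Lr) r)
          = MvPolynomial.C (Ideal.Quotient.mk
              (Ideal.span {x | ∃ i, 0 < L i ∧ x = u i}) r)) ∧
      (∀ (i : Fin d) (hi : 0 < L i),
        ∃ hui : AddMonoidAlgebra.single (Lr i) (u i) ∈ ReesAlgebra y u l Lr,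
          e (Ideal.Quotient.mk (grIdeal y u l Lr)
              ⟨AddMonoidAlgebra.single (Lr i) (u i), hui⟩)
            = MvPolynomial.X ⟨i, hi⟩) := by
  have hnoe : IsNoetherianRing R := hreg.1
  have hu : RegFam u :=
    (regFam_of_sop (Fin.cons y u) hrsp.1 hrsp.2).comp (κ := Fin d) Fin.succ (Fin.succ_injective d)
  clear hl
  subst hl0
  subst hLr
  set w : Fin d → ℝ := fun i => (L i : ℝ) with hwdef
  have hw : ∀ i, 0 ≤ w i := fun i => by simpa [hwdef] using hL0 i
  have hP : ∀ i, 0 < L i ↔ 0 < w i := fun i => by simp [hwdef]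
  set J := Ideal.span {x | ∃ i, 0 < L i ∧ x = u i} with hJ
  have hJ' : J = Ideal.span (Set.range fun i : {i // 0 < L i} => u i) := by
    rw [hJ]; congr 1; ext x
    constructor
    · rintro ⟨i, hi, rfl⟩; exact ⟨⟨i, hi⟩, rfl⟩
    · rintro ⟨i, rfl⟩; exact ⟨i, i.2, rfl⟩
  let ψ : MvPolynomial {i // 0 < L i} R →+* GrRing y u 0 w := (psi y u w fun i => 0 < L i).toRingHom
  have hψ : Function.Surjective ψ := psi_surjective y u w _ hP hw
  let θ : MvPolynomial {i // 0 < L i} R →+* MvPolynomial {i // 0 < L i} (R ⧸ J) :=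
    MvPolynomial.map (Ideal.Quotient.mk J)
  have hθ : Function.Surjective θ :=
    MvPolynomial.map_surjective _ Ideal.Quotient.mk_surjective
  have hker : RingHom.ker ψ = RingHom.ker θ := by
    apply le_antisymm
    · intro p hp
      have hp' : phi y u w (fun i => 0 < L i) p ∈ grIdeal y u 0 w :=
        Ideal.Quotient.eq_zero_iff_mem.mp hp
      rw [RingHom.mem_ker]
      ext a
      rw [MvPolynomial.coeff_map, MvPolynomial.coeff_zero, Ideal.Quotient.eq_zero_iff_mem, hJ']
      exact phi_inj_aux y u w _ hP hw hu p hp' a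
    · change RingHom.ker (MvPolynomial.map (Ideal.Quotient.mk J)) ≤ _
      rw [MvPolynomial.ker_map, Ideal.mk_ker, hJ', Ideal.map_span, Ideal.span_le]
      rintro _ ⟨_, ⟨i, rfl⟩, rfl⟩
      refine Ideal.Quotient.eq_zero_iff_mem.mpr (Ideal.subset_span ?_)
      refine ⟨0, u i, ⟨w i, (hP i).mp i.2, u_mem_monIdeal y u w i⟩, ?_⟩
      have := phi_monomial y u w (fun i => 0 < L i) 0 (u i)
      simpa using this
  let e : GrRing y u 0 w ≃+* MvPolynomial {i // 0 < L i} (R ⧸ J) :=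
    (RingHom.quotientKerEquivOfSurjective hψ).symm.trans
      ((Ideal.quotEquivOfEq hker).trans (RingHom.quotientKerEquivOfSurjective hθ))
  have he : ∀ p, e (ψ p) = θ p := by
    intro p
    simp [e]
  refine ⟨e, fun r => ?_, fun i hi => ⟨single_mem_rees y u w (u_mem_monIdeal y u w i), ?_⟩⟩
  · have h1 : algebraMap R (GrRing y u 0 w) r = ψ (MvPolynomial.C r) :=
      ((psi y u w fun i => 0 < L i).commutes r).symm
    rw [h1, he]
    exact MvPolynomial.map_C _ _
  · have h1 : Ideal.Quotient.mk (grIdeal y u 0 w)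
        ⟨AddMonoidAlgebra.single (w i) (u i), single_mem_rees y u w (u_mem_monIdeal y u w i)⟩
        = ψ (MvPolynomial.X ⟨i, hi⟩) := by
      refine congrArg (Ideal.Quotient.mk (grIdeal y u 0 w)) ?_
      exact (phi_X y u w (fun i => 0 < L i) ⟨i, hi⟩).symm
    refine (congrArg e h1).trans ((he _).trans ?_)
    exact MvPolynomial.map_X _ _

end CharPolyhedra
end
end
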